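/- arXiv:2402.13451 — 2 statements merged into one kernel-verified Lean document; each statement's English description precedes it below -/
import Mathlib

section
/- Let n ≥ 4 and let ‖·‖ be any norm on ℝⁿ. Then there exists c_n = c_n(‖·‖) > 0 such that for every c ∈ [0, c_n], the set FS_n(‖·‖, c) = DI_n(‖·‖, c) \ Bad_n has Hausdorff dimension at least n − 2. In particular, the Dirichlet spectrum {Θ(‖·‖, ξ) : ξ ∈ ℝⁿ} contains some right neighborhood of 0. -/
open Filter MeasureTheory
open scoped ENNReal

/-- `N` is a norm on `ℝ^k` (viewed as `Fin k → ℝ`). -/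
def IsNorm {k : ℕ} (N : (Fin k → ℝ) → ℝ) : Prop :=
  (∀ x, N x = 0 ↔ x = 0) ∧ (∀ (c : ℝ) (x : Fin k → ℝ), N (c • x) = |c| * N x) ∧
    ∀ x y, N (x + y) ≤ N x + N y

/-- `ψ_ξ(‖·‖,t)`: the minimum of `|b₁ξ₁+⋯+b_nξ_n+b_{n+1}|` over integer vectors
`(b₁,…,b_{n+1})` with `1 ≤ ‖(b₁,…,b_n)‖ ≤ t`. -/
noncomputable def psiDualN (n : ℕ) (N : (Fin n → ℝ) → ℝ) (ξ : Fin n → ℝ) (t : ℝ) : ℝ :=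
  sInf { r : ℝ | ∃ (b : Fin n → ℤ) (b' : ℤ),
    1 ≤ N (fun i => (b i : ℝ)) ∧ N (fun i => (b i : ℝ)) ≤ t ∧
    r = |(∑ i, (b i : ℝ) * ξ i) + (b' : ℝ)| }

/-- `Θ(‖·‖,ξ) = limsup_{t→∞} tⁿ ψ_ξ(‖·‖,t)`. -/
noncomputable def ThetaDualN (n : ℕ) (N : (Fin n → ℝ) → ℝ) (ξ : Fin n → ℝ) : ℝ :=
  limsup (fun t : ℝ => t ^ n * psiDualN n N ξ t) atTop

/-- `Θ̃(‖·‖,ξ) = liminf_{t→∞} tⁿ ψ_ξ(‖·‖,t)`. -/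
noncomputable def ThetaTildeDualN (n : ℕ) (N : (Fin n → ℝ) → ℝ) (ξ : Fin n → ℝ) : ℝ :=
  liminf (fun t : ℝ => t ^ n * psiDualN n N ξ t) atTop

/-- `FS_n(‖·‖,c) = DI_n(‖·‖,c) \ Bad_n`. -/
def FSdualN (n : ℕ) (N : (Fin n → ℝ) → ℝ) (c : ℝ) : Set (Fin n → ℝ) :=
  {ξ | ThetaDualN n N ξ = c} \ {ξ | 0 < ThetaTildeDualN n N ξ}

open Topology

lemma IsNorm.nonneg {k : ℕ} {N : (Fin k → ℝ) → ℝ} (hN : IsNorm N) (x : Fin k → ℝ) :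
    0 ≤ N x := by
  have h1 := hN.2.2 x (-x)
  have h2 := hN.2.1 (-1) x
  have h3 := (hN.1 0).2 rfl
  simp only [neg_smul, one_smul, abs_neg, abs_one, one_mul] at h2
  rw [add_neg_cancel, h3, h2] at h1
  linarith

lemma IsNorm.continuous {k : ℕ} {N : (Fin k → ℝ) → ℝ} (hN : IsNorm N) : Continuous N := by
  let p : Seminorm ℝ (Fin k → ℝ) := Seminorm.of N hN.2.2 (fun a x => hN.2.1 a x)
  have hp : ConvexOn ℝ Set.univ N := p.convexOn
  exact continuousOn_univ.1 (hp.continuousOn isOpen_univ)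

/-- Any norm on `ℝ^k` dominates a positive multiple of the sup norm. -/
lemma IsNorm.exists_pos_mul_norm_le {k : ℕ} {N : (Fin k → ℝ) → ℝ} (hN : IsNorm N) :
    ∃ κ : ℝ, 0 < κ ∧ ∀ x, κ * ‖x‖ ≤ N x := by
  rcases (Metric.sphere (0 : Fin k → ℝ) 1).eq_empty_or_nonempty with h | h
  · refine ⟨1, one_pos, fun x => ?_⟩
    by_cases hx : x = 0
    · simp [hx, (hN.1 0).2 rfl]
    · have : ‖x‖⁻¹ • x ∈ Metric.sphere (0 : Fin k → ℝ) 1 := by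
        simp [norm_smul, norm_ne_zero_iff.2 hx]
      simp [h] at this
  · obtain ⟨y, hy, hmin⟩ := (isCompact_sphere (0 : Fin k → ℝ) 1).exists_isMinOn h
      hN.continuous.continuousOn
    have hy1 : ‖y‖ = 1 := by simpa using hy
    have hy0 : y ≠ 0 := by
      rintro rfl
      simp at hy1
    refine ⟨N y, lt_of_le_of_ne (hN.nonneg y) fun h => hy0 ((hN.1 y).1 h.symm), fun x => ?_⟩
    by_cases hx : x = 0
    · simp [hx, (hN.1 0).2 rfl]
    · have hx' : 0 < ‖x‖ := norm_pos_iff.2 hx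
      have hs : ‖x‖⁻¹ • x ∈ Metric.sphere (0 : Fin k → ℝ) 1 := by
        simp [norm_smul, hx'.ne']
      have := isMinOn_iff.1 hmin _ hs
      rw [hN.2.1, abs_of_pos (inv_pos.2 hx'), inv_mul_eq_div, le_div_iff₀ hx'] at this
      exact this

/-- If eventually `μ (E k) ≤ r < 1`, then with positive probability infinitely many of the events
`E k` fail. -/
lemma measure_frequently_notMem_ne_zero {Ω : Type*} [MeasurableSpace Ω] (μ : Measure Ω)
    [IsProbabilityMeasure μ] (E : ℕ → Set Ω) {r : ℝ≥0∞} (hr : r < 1)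
    (hE : ∀ᶠ k in atTop, μ (E k) ≤ r) : μ {x | ∃ᶠ k in atTop, x ∉ E k} ≠ 0 := by
  obtain ⟨K, hK⟩ := eventually_atTop.1 hE
  have hmono : Monotone fun j : ℕ => {x | ∀ k, j ≤ k → x ∈ E k} :=
    fun i j hij x hx k hk => hx k (hij.trans hk)
  have hU : μ (⋃ j : ℕ, {x | ∀ k, j ≤ k → x ∈ E k}) ≤ r := by
    rw [hmono.measure_iUnion]
    refine iSup_le fun j => (measure_mono ?_).trans (hK (max j K) (le_max_right _ _))
    exact fun x hx => hx _ (le_max_left _ _)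
  intro h0
  have hcov : (Set.univ : Set Ω) ⊆
      {x | ∃ᶠ k in atTop, x ∉ E k} ∪ ⋃ j : ℕ, {x | ∀ k, j ≤ k → x ∈ E k} := by
    intro x _
    by_cases hx : ∃ᶠ k in atTop, x ∉ E k
    · exact Or.inl hx
    · rw [not_frequently] at hx
      obtain ⟨j, hj⟩ := eventually_atTop.1 hx
      exact Or.inr (Set.mem_iUnion.2 ⟨j, fun k hk => not_not.1 (hj k hk)⟩)
  have h1 : (1 : ℝ≥0∞) ≤ r := by
    calc (1 : ℝ≥0∞) = μ Set.univ := measure_univ.symm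
      _ ≤ _ := measure_mono hcov
      _ ≤ _ := measure_union_le _ _
      _ ≤ r := by rw [h0, zero_add]; exact hU
  exact absurd hr (not_lt.2 h1)

/-- Lebesgue measure on the unit cube. -/
noncomputable def cubeMeasure (m : ℕ) : Measure (Fin m → ℝ) :=
  volume.restrict (Set.univ.pi fun _ => Set.Ioc 0 1)

instance (m : ℕ) : IsProbabilityMeasure (cubeMeasure m) := by
  constructor
  simp [cubeMeasure, Real.volume_pi_Ioc]

lemma UnitAddCircle.norm_coe_le (x : ℝ) : ‖(x : UnitAddCircle)‖ ≤ |x| := by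
  rw [UnitAddCircle.norm_eq]
  simpa using round_le x 0

lemma measurePreserving_coe_pi (m : ℕ) :
    MeasurePreserving (fun (η : Fin m → ℝ) i => (η i : UnitAddCircle)) (cubeMeasure m) volume := by
  have h := measurePreserving_pi (ι := Fin m)
    (fun _ => (volume : Measure ℝ).restrict (Set.Ioc 0 (0 + 1)))
    (fun _ => (volume : Measure UnitAddCircle)) (fun _ => UnitAddCircle.measurePreserving_mk 0)
  rw [← Measure.restrict_pi_pi] at h
  simpa [cubeMeasure] using! h

/-- The character `y ↦ ∑ vᵢ yᵢ` of the torus. -/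
noncomputable def torusChar {m : ℕ} (v : Fin m → ℤ) : (Fin m → UnitAddCircle) →+ UnitAddCircle where
  toFun y := ∑ i, v i • y i
  map_zero' := by simp
  map_add' x y := by simp [Finset.sum_add_distrib]

lemma torusChar_coe {m : ℕ} (v : Fin m → ℤ) (η : Fin m → ℝ) :
    torusChar v (fun i => (η i : UnitAddCircle)) = ((∑ i, (v i : ℝ) * η i : ℝ) : UnitAddCircle) := by
  have := map_sum (QuotientAddGroup.mk' (AddSubgroup.zmultiples (1 : ℝ)))
    (fun i => (v i : ℝ) * η i) Finset.univ
  simp only [QuotientAddGroup.coe_mk'] at this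
  refine Eq.trans ?_ this.symm
  simp only [torusChar, AddMonoidHom.coe_mk, ZeroHom.coe_mk]
  refine Finset.sum_congr rfl fun i _ => ?_
  rw [← zsmul_eq_mul]
  rfl

lemma torusChar_surjective {m : ℕ} {v : Fin m → ℤ} (hv : v ≠ 0) :
    Function.Surjective (torusChar v) := by
  obtain ⟨j, hj⟩ := Function.ne_iff.1 hv
  intro y
  obtain ⟨x, rfl⟩ := QuotientAddGroup.mk_surjective y
  refine ⟨fun i => (Pi.single (M := fun _ => ℝ) j (x / v j) i : ℝ), ?_⟩
  rw [torusChar_coe]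
  have hj' : (v j : ℝ) ≠ 0 := by exact_mod_cast hj
  congr 1
  rw [Finset.sum_eq_single j]
  · simp [mul_div_cancel₀ _ hj']
  · intro i _ hi
    simp [hi]
  · simp

lemma measurePreserving_torusChar {m : ℕ} {v : Fin m → ℤ} (hv : v ≠ 0) :
    MeasurePreserving (torusChar v) volume volume := by
  refine AddMonoidHom.measurePreserving ?_ (torusChar_surjective hv) ?_
  · change Continuous fun y : Fin m → UnitAddCircle => ∑ i, v i • y i
    fun_prop
  · rw [volume_pi, Measure.pi_univ]
    simp

/-- The set of `η` in the unit cube at which an inhomogeneous linear form with nonzero integer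
coefficients is within `δ` of an integer has measure at most `2δ`. -/
lemma cubeMeasure_near_integer_le {m : ℕ} {v : Fin m → ℤ} (hv : v ≠ 0) (s δ : ℝ) :
    cubeMeasure m {η | ∃ b : ℤ, |∑ i, (v i : ℝ) * η i + s + b| ≤ δ} ≤ ENNReal.ofReal (2 * δ) := by
  have hmp := (measurePreserving_torusChar hv).comp (measurePreserving_coe_pi m)
  calc cubeMeasure m {η | ∃ b : ℤ, |∑ i, (v i : ℝ) * η i + s + b| ≤ δ}
      ≤ cubeMeasure m ((torusChar v ∘ fun (η : Fin m → ℝ) i => (η i : UnitAddCircle)) ⁻¹'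
          Metric.closedBall ((-s : ℝ) : UnitAddCircle) δ) := by
        refine measure_mono ?_
        rintro η ⟨b, hb⟩
        simp only [Set.mem_preimage, Function.comp_apply, torusChar_coe, Metric.mem_closedBall,
          dist_eq_norm]
        refine le_trans ?_ hb
        refine le_trans (le_of_eq ?_) (UnitAddCircle.norm_coe_le _)
        congr 1
        rw [← AddCircle.coe_sub, sub_neg_eq_add, AddCircle.coe_add _ (_ + s) (b : ℝ)]
        have : ((b : ℝ) : UnitAddCircle) = 0 := by
          rw [AddCircle.coe_eq_zero_iff]
          exact ⟨b, by simp⟩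
        rw [this, add_zero]
    _ = volume (Metric.closedBall ((-s : ℝ) : UnitAddCircle) δ) :=
        hmp.measure_preimage Metric.isClosed_closedBall.measurableSet.nullMeasurableSet
    _ ≤ ENNReal.ofReal (2 * δ) := by
        rw [AddCircle.volume_closedBall]
        exact ENNReal.ofReal_le_ofReal (min_le_right _ _)

/-- Sets of positive Lebesgue measure in the unit cube have full Hausdorff dimension. -/
lemma le_dimH_of_cubeMeasure_ne_zero {m : ℕ} {F : Set (Fin m → ℝ)} (hF : cubeMeasure m F ≠ 0) :
    (m : ℝ≥0∞) ≤ dimH F := by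
  have h : μH[(m : NNReal)] F ≠ 0 := by
    have := hausdorffMeasure_pi_real (ι := Fin m)
    rw [Fintype.card_fin] at this
    rw [NNReal.coe_natCast, this]
    exact fun h => hF (le_antisymm ((Measure.restrict_apply_le _ _).trans h.le) zero_le)
  simpa using le_dimH_of_hausdorffMeasure_ne_zero h

/-- The numerical relations between heights `X`, linear form values `L` and denominators `Q`
which hold along a chain whose multipliers are adjusted to a constant `c`. -/
structure HeightData (p : ℕ) (c C : ℝ) (X L Q : ℕ → ℝ) : Prop where
  c_pos : 0 < c
  C_pos : 0 < C
  X_pos : ∀ k, 0 < X k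
  L_nonneg : ∀ k, 0 ≤ L k
  Q_pos : ∀ k, 0 < Q k
  Q_le : ∀ k, Q k ≤ C * X k * X (k + 1)
  le_Q : ∀ k, X (k + 2) ^ (p + 3) ≤ c * Q (k + 2)
  Q_le' : ∀ k, c * Q (k + 3) ≤ X (k + 3) ^ (p + 3) + c * (Q (k + 2) + Q k)
  sum_eq : ∀ k, L (k + 1) * Q (k + 2) + L (k + 2) * Q k + L (k + 3) * Q (k + 1) = 1
  small : 2 * c * C ≤ X 2 ^ (p + 1)

namespace HeightData

variable {p : ℕ} {c C : ℝ} {X L Q : ℕ → ℝ}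

lemma pow_le (h : HeightData p c C X L Q) (k : ℕ) :
    X (k + 2) ^ (p + 2) ≤ c * C * X (k + 3) := by
  have h1 := (h.le_Q k).trans (mul_le_mul_of_nonneg_left (h.Q_le (k + 2)) h.c_pos.le)
  have h2 := h.X_pos (k + 2)
  refine le_of_mul_le_mul_right ?_ h2
  calc X (k + 2) ^ (p + 2) * X (k + 2) = X (k + 2) ^ (p + 3) := by ring
    _ ≤ _ := h1
    _ = _ := by ring

lemma two_mul_le_aux (h : HeightData p c C X L Q) (k : ℕ) :
    X 2 ≤ X (k + 2) ∧ 2 * X (k + 2) ≤ X (k + 3) := by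
  have step : ∀ k, X 2 ≤ X (k + 2) → 2 * X (k + 2) ≤ X (k + 3) := by
    intro k hk
    have h1 : 2 * c * C ≤ X (k + 2) ^ (p + 1) :=
      h.small.trans (pow_le_pow_left₀ (h.X_pos 2).le hk _)
    have h2 := h.X_pos (k + 2)
    have h3 := h.pow_le k
    have h4 : 0 < c * C := mul_pos h.c_pos h.C_pos
    refine le_of_mul_le_mul_left ?_ h4
    calc c * C * (2 * X (k + 2)) = 2 * c * C * X (k + 2) := by ring
      _ ≤ X (k + 2) ^ (p + 1) * X (k + 2) := mul_le_mul_of_nonneg_right h1 h2.le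
      _ = X (k + 2) ^ (p + 2) := by ring
      _ ≤ _ := h3
  induction k with
  | zero => exact ⟨le_rfl, step 0 le_rfl⟩
  | succ k ih =>
    have h1 : X 2 ≤ X (k + 1 + 2) := by
      have := h.X_pos (k + 2)
      have := ih.2
      rw [show k + 1 + 2 = k + 3 from rfl]
      linarith [ih.1]
    exact ⟨h1, step _ h1⟩

lemma le_succ (h : HeightData p c C X L Q) (k : ℕ) : X (k + 2) ≤ X (k + 3) := by
  linarith [(h.two_mul_le_aux k).2, h.X_pos (k + 2)]

lemma tendsto_X (h : HeightData p c C X L Q) : Tendsto X atTop atTop := by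
  rw [← tendsto_add_atTop_iff_nat 2]
  have : ∀ k, X 2 * 2 ^ k ≤ X (k + 2) := by
    intro k
    induction k with
    | zero => simp
    | succ k ih =>
      have := (h.two_mul_le_aux k).2
      rw [show k + 1 + 2 = k + 3 from rfl, pow_succ]
      linarith
  exact tendsto_atTop_mono this
    ((tendsto_pow_atTop_atTop_of_one_lt one_lt_two).const_mul_atTop (h.X_pos 2))

lemma tendsto_const_div_pow (h : HeightData p c C X L Q) (a : ℝ) :
    Tendsto (fun k => a / X k ^ (p + 1)) atTop (𝓝 0) :=
  ((tendsto_pow_atTop (Nat.succ_ne_zero p)).comp h.tendsto_X).const_div_atTop a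

lemma tendsto_ratio (h : HeightData p c C X L Q) :
    Tendsto (fun k => X k / X (k + 1)) atTop (𝓝 0) := by
  rw [← tendsto_add_atTop_iff_nat 2]
  refine squeeze_zero (fun k => (div_pos (h.X_pos _) (h.X_pos _)).le) (fun k => ?_)
    ((tendsto_add_atTop_iff_nat 2).2 (h.tendsto_const_div_pow (c * C)))
  have h1 := h.X_pos (k + 2)
  have h2 := h.X_pos (k + 3)
  rw [show k + 2 + 1 = k + 3 from rfl, div_le_div_iff₀ h2 (by positivity)]
  calc X (k + 2) * X (k + 2) ^ (p + 1) = X (k + 2) ^ (p + 2) := by ring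
    _ ≤ _ := h.pow_le k

lemma tendsto_Q_ratio (h : HeightData p c C X L Q) :
    Tendsto (fun k => Q k / Q (k + 1)) atTop (𝓝 0) := by
  rw [← tendsto_add_atTop_iff_nat 2]
  refine squeeze_zero (fun k => (div_pos (h.Q_pos _) (h.Q_pos _)).le) (fun k => ?_)
    ((tendsto_add_atTop_iff_nat 3).2 (h.tendsto_const_div_pow (c * C)))
  have h1 := h.X_pos (k + 2)
  have h2 := h.X_pos (k + 3)
  have h3 := h.Q_pos (k + 3)
  have hC := h.C_pos
  have hc := h.c_pos
  rw [show k + 2 + 1 = k + 3 from rfl, div_le_div_iff₀ h3 (by positivity)]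
  calc Q (k + 2) * X (k + 3) ^ (p + 1)
      ≤ (C * X (k + 3) * X (k + 3)) * X (k + 3) ^ (p + 1) := by
        refine mul_le_mul_of_nonneg_right ((h.Q_le (k + 2)).trans ?_) (by positivity)
        have := h.le_succ k
        gcongr
    _ = C * X (k + 3) ^ (p + 3) := by ring
    _ ≤ C * (c * Q (k + 3)) := mul_le_mul_of_nonneg_left (h.le_Q (k + 1)) hC.le
    _ = _ := by ring

lemma L_mul_Q_le (h : HeightData p c C X L Q) (k : ℕ) : L (k + 1) * Q (k + 2) ≤ 1 := by
  have h1 := mul_nonneg (h.L_nonneg (k + 2)) (h.Q_pos k).le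
  have h2 := mul_nonneg (h.L_nonneg (k + 3)) (h.Q_pos (k + 1)).le
  linarith [h.sum_eq k]

lemma pow_mul_L_le (h : HeightData p c C X L Q) (k : ℕ) :
    X (k + 2) ^ (p + 3) * L (k + 1) ≤ c := by
  calc X (k + 2) ^ (p + 3) * L (k + 1) ≤ c * Q (k + 2) * L (k + 1) :=
        mul_le_mul_of_nonneg_right (h.le_Q k) (h.L_nonneg _)
    _ = c * (L (k + 1) * Q (k + 2)) := by ring
    _ ≤ c * 1 := mul_le_mul_of_nonneg_left (h.L_mul_Q_le k) h.c_pos.le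
    _ = c := mul_one c

lemma tendsto_pow_mul_L (h : HeightData p c C X L Q) :
    Tendsto (fun k => X (k + 1) ^ (p + 3) * L k) atTop (𝓝 c) := by
  rw [← tendsto_add_atTop_iff_nat 2]
  set r : ℕ → ℝ := fun k => Q k / Q (k + 1) with hr
  have hr0 : Tendsto r atTop (𝓝 0) := h.tendsto_Q_ratio
  have hrk : ∀ j, Tendsto (fun k => r (k + j)) atTop (𝓝 0) :=
    fun j => (tendsto_add_atTop_iff_nat j).2 hr0
  have hlow : Tendsto (fun k => c * (1 - r (k + 1) * r (k + 2) * r (k + 3)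
      - r (k + 2) * r (k + 3) * r (k + 4) - r (k + 2) - r k * r (k + 1) * r (k + 2)))
      atTop (𝓝 c) := by
    have := ((((tendsto_const_nhds (x := (1 : ℝ))).sub (((hrk 1).mul (hrk 2)).mul (hrk 3))).sub
      (((hrk 2).mul (hrk 3)).mul (hrk 4))).sub (hrk 2)).sub ((hr0.mul (hrk 1)).mul (hrk 2))
    simpa using this.const_mul c
  refine tendsto_of_tendsto_of_tendsto_of_le_of_le hlow tendsto_const_nhds (fun k => ?_)
    (fun k => h.pow_mul_L_le (k + 1))
  have hQ := h.Q_pos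
  have e1 : ∀ k, r k * r (k + 1) * r (k + 2) = Q k / Q (k + 3) := by
    intro k
    have := hQ k; have := hQ (k + 1); have := hQ (k + 2); have := hQ (k + 3)
    simp only [hr]
    rw [show k + 1 + 1 = k + 2 from rfl, show k + 2 + 1 = k + 3 from rfl]
    field_simp
  have hL : ∀ k, L (k + 1) ≤ 1 / Q (k + 2) := fun k => by
    rw [le_div_iff₀ (hQ _)]; exact h.L_mul_Q_le k
  have b1 : L (k + 3) * Q (k + 1) ≤ Q (k + 1) / Q (k + 4) := by
    calc L (k + 3) * Q (k + 1) ≤ 1 / Q (k + 4) * Q (k + 1) :=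
          mul_le_mul_of_nonneg_right (hL (k + 2)) (hQ _).le
      _ = _ := by ring
  have b2 : L (k + 4) * Q (k + 2) ≤ Q (k + 2) / Q (k + 5) := by
    calc L (k + 4) * Q (k + 2) ≤ 1 / Q (k + 5) * Q (k + 2) :=
          mul_le_mul_of_nonneg_right (hL (k + 3)) (hQ _).le
      _ = _ := by ring
  have b3 : L (k + 2) * (Q (k + 2) + Q k) ≤ Q (k + 2) / Q (k + 3) + Q k / Q (k + 3) := by
    calc L (k + 2) * (Q (k + 2) + Q k) ≤ 1 / Q (k + 3) * (Q (k + 2) + Q k) :=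
          mul_le_mul_of_nonneg_right (hL (k + 1)) (add_pos (hQ _) (hQ _)).le
      _ = _ := by ring
  have s := h.sum_eq (k + 1)
  have t := mul_le_mul_of_nonneg_right (h.Q_le' k) (h.L_nonneg (k + 2))
  have e2 := e1 (k + 1)
  have e3 := e1 (k + 2)
  have e4 : r (k + 2) = Q (k + 2) / Q (k + 3) := rfl
  simp only [show k + 1 + 1 = k + 2 from rfl, show k + 1 + 2 = k + 3 from rfl,
    show k + 1 + 3 = k + 4 from rfl, show k + 2 + 3 = k + 5 from rfl] at e2 e3 s ⊢
  rw [e2, e3, e1 k, e4]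
  have hc := h.c_pos
  have key : 1 - Q (k + 1) / Q (k + 4) - Q (k + 2) / Q (k + 5) - Q (k + 2) / Q (k + 3)
      - Q k / Q (k + 3) ≤ L (k + 2) * Q (k + 3) - L (k + 2) * (Q (k + 2) + Q k) := by
    linarith
  calc _ ≤ c * (L (k + 2) * Q (k + 3) - L (k + 2) * (Q (k + 2) + Q k)) :=
        mul_le_mul_of_nonneg_left key hc.le
    _ ≤ _ := by linarith

lemma eventually_L_small (h : HeightData p c C X L Q) {ε : ℝ} (hε : 0 < ε) :
    ∀ᶠ k in atTop, L (k + 1) ≤ ε * L k := by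
  have h1 : ∀ᶠ k in atTop, c / 2 < X (k + 1) ^ (p + 3) * L k :=
    h.tendsto_pow_mul_L.eventually (lt_mem_nhds (half_lt_self h.c_pos))
  have h2 : Tendsto (fun k => (X (k + 1) / X (k + 2)) ^ (p + 3)) atTop (𝓝 0) := by
    have := ((tendsto_add_atTop_iff_nat 1).2 h.tendsto_ratio).pow (p + 3)
    simpa using this
  filter_upwards [h1, h2.eventually (gt_mem_nhds (half_pos hε))] with k h1 h2
  have h3 := h.pow_mul_L_le k
  have x1 := h.X_pos (k + 1)
  have x2 := h.X_pos (k + 2)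
  rw [div_pow, div_lt_iff₀ (by positivity)] at h2
  have l1 := h.L_nonneg (k + 1)
  have l0 := h.L_nonneg k
  by_contra! hcon
  have i1 : X (k + 1) ^ (p + 3) * L (k + 1) ≤ ε / 2 * c := by
    calc X (k + 1) ^ (p + 3) * L (k + 1) ≤ ε / 2 * X (k + 2) ^ (p + 3) * L (k + 1) :=
          mul_le_mul_of_nonneg_right h2.le l1
      _ = ε / 2 * (X (k + 2) ^ (p + 3) * L (k + 1)) := by ring
      _ ≤ _ := mul_le_mul_of_nonneg_left h3 (half_pos hε).le
  have i2 : X (k + 1) ^ (p + 3) * (ε * L k) < X (k + 1) ^ (p + 3) * L (k + 1) :=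
    mul_lt_mul_of_pos_left hcon (by positivity)
  have i3 := mul_lt_mul_of_pos_left h1 hε
  linarith

lemma eventually_L_mul_sq (h : HeightData p c C X L Q) (B : ℝ) :
    ∀ᶠ k in atTop, B * L k * X (k + 1) ^ 2 < 1 := by
  have h2 : Tendsto (fun k => X (k + 1) ^ (p + 3) * L k * (B / X (k + 1) ^ (p + 1)))
      atTop (𝓝 0) := by
    have := h.tendsto_pow_mul_L.mul ((tendsto_add_atTop_iff_nat 1).2 (h.tendsto_const_div_pow B))
    simpa using this
  filter_upwards [h2.eventually (gt_mem_nhds one_pos)] with k hk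
  have x1 := h.X_pos (k + 1)
  refine lt_of_eq_of_lt ?_ hk
  field_simp
  ring

end HeightData

/-- The data of integer vectors `(x k, y k, z k)` produced by the recursion
`b (k + 3) = b k - s k • b (k + 1)` from `(1, 0, 0)`, `(0, 1, 0)`, `(-1, -1, 1)`. -/
structure IsChain3 (x y z : ℕ → ℤ) (s : ℕ → ℕ) : Prop where
  x0 : x 0 = 1
  x1 : x 1 = 0
  x2 : x 2 = -1
  y0 : y 0 = 0
  y1 : y 1 = 1
  y2 : y 2 = -1
  z0 : z 0 = 0
  z1 : z 1 = 0
  z2 : z 2 = 1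
  hx : ∀ k, x (k + 3) = x k - s k * x (k + 1)
  hy : ∀ k, y (k + 3) = y k - s k * y (k + 1)
  hz : ∀ k, z (k + 3) = z k - s k * z (k + 1)

/-- Chains exist for any rule choosing the multiplier from the current vectors. -/
lemma exists_isChain3 (f : ℤ → ℤ → ℤ → ℤ → ℕ) :
    ∃ (x y z : ℕ → ℤ) (s : ℕ → ℕ), IsChain3 x y z s ∧
      ∀ k, s k = f (x (k + 1)) (y (k + 1)) (x (k + 2)) (y (k + 2)) := by
  let st : ℕ → (ℤ × ℤ × ℤ) × (ℤ × ℤ × ℤ) × (ℤ × ℤ × ℤ) :=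
    fun k => Nat.rec ((1, 0, 0), (0, 1, 0), (-1, -1, 1))
      (fun _ p => (p.2.1, p.2.2, p.1 - (f p.2.1.1 p.2.1.2.1 p.2.2.1 p.2.2.2.1 : ℤ) • p.2.1)) k
  exact ⟨fun k => (st k).1.1, fun k => (st k).1.2.1, fun k => (st k).1.2.2,
    fun k => f (st (k + 1)).1.1 (st (k + 1)).1.2.1 (st (k + 2)).1.1 (st (k + 2)).1.2.1,
    ⟨rfl, rfl, rfl, rfl, rfl, rfl, rfl, rfl, rfl, fun k => rfl, fun k => rfl, fun k => rfl⟩,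
    fun k => rfl⟩

namespace IsChain3

variable {x y z : ℕ → ℤ} {s : ℕ → ℕ}

/-- The denominators attached to a chain. -/
def q (x y : ℕ → ℤ) (k : ℕ) : ℤ := x k * y (k + 1) - y k * x (k + 1)

lemma q_rec (h : IsChain3 x y z s) (k : ℕ) : q x y (k + 3) = s (k + 1) * q x y (k + 2) + q x y k := by
  simp only [q, h.hx (k + 1), h.hy (k + 1), show k + 3 + 1 = k + 1 + 3 from rfl]
  rw [show k + 1 + 1 = k + 2 from rfl, show k + 2 + 1 = k + 3 from rfl, h.hx k, h.hy k]
  ring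

lemma q_zero (h : IsChain3 x y z s) : q x y 0 = 1 := by
  simp [q, h.x0, h.x1, h.y0, h.y1]

lemma q_one (h : IsChain3 x y z s) : q x y 1 = 1 := by
  simp [q, h.x2, h.x1, h.y2, h.y1]

lemma q_two (h : IsChain3 x y z s) : q x y 2 = s 0 + 1 := by
  have h1 := h.hx 0
  have h2 := h.hy 0
  simp only [zero_add, h.x0, h.x1, h.y0, h.y1] at h1 h2
  simp [q, h.x2, h.y2, h1, h2]

lemma q_pos (h : IsChain3 x y z s) (k : ℕ) : 0 < q x y k := by
  induction k using Nat.strong_induction_on with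
  | _ k ih =>
    match k, ih with
    | 0, _ => simp [h.q_zero]
    | 1, _ => simp [h.q_one]
    | 2, _ => rw [h.q_two]; positivity
    | k + 3, ih =>
      rw [h.q_rec]
      have := ih k (by omega)
      have h2 := ih (k + 2) (by omega)
      positivity

lemma det_eq_one (h : IsChain3 x y z s) (k : ℕ) :
    x k * (y (k + 1) * z (k + 2) - z (k + 1) * y (k + 2))
      - y k * (x (k + 1) * z (k + 2) - z (k + 1) * x (k + 2))
      + z k * (x (k + 1) * y (k + 2) - y (k + 1) * x (k + 2)) = 1 := by
  induction k with
  | zero => simp [h.x0, h.x1, h.x2, h.y0, h.y1, h.y2, h.z0, h.z1, h.z2]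
  | succ k ih =>
    rw [show k + 1 + 2 = k + 3 from rfl, show k + 1 + 1 = k + 2 from rfl, h.hx, h.hy, h.hz]
    linear_combination ih

/-- An integer vector in the plane spanned by two consecutive vectors of a chain is an integer
combination of them. -/
lemma exists_combination (h : IsChain3 x y z s) (k : ℕ) {a b c : ℤ}
    (h0 : a * (y k * z (k + 1) - z k * y (k + 1)) - b * (x k * z (k + 1) - z k * x (k + 1))
      + c * (x k * y (k + 1) - y k * x (k + 1)) = 0) :
    ∃ m m' : ℤ, a = m * x k + m' * x (k + 1) ∧ b = m * y k + m' * y (k + 1) ∧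
      c = m * z k + m' * z (k + 1) := by
  refine ⟨a * (y (k + 1) * z (k + 2) - z (k + 1) * y (k + 2))
      - b * (x (k + 1) * z (k + 2) - z (k + 1) * x (k + 2))
      + c * (x (k + 1) * y (k + 2) - y (k + 1) * x (k + 2)),
    -(a * (y k * z (k + 2) - z k * y (k + 2))
      - b * (x k * z (k + 2) - z k * x (k + 2))
      + c * (x k * y (k + 2) - y k * x (k + 2))), ?_, ?_, ?_⟩
  · linear_combination (-a) * h.det_eq_one k + x (k + 2) * h0
  · linear_combination (-b) * h.det_eq_one k + y (k + 2) * h0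
  · linear_combination (-c) * h.det_eq_one k + z (k + 2) * h0

lemma exists_nonneg_upto (h : IsChain3 x y z s) (K : ℕ) :
    ∃ α β : ℝ, 0 ≤ α ∧ 0 ≤ β ∧ α ≤ 1 ∧ β ≤ 1 ∧ ∀ k ≤ K, 0 ≤ x k * α + y k * β + z k := by
  set w1 : ℤ := y K * z (K + 1) - z K * y (K + 1) with hw1
  set w2 : ℤ := z K * x (K + 1) - x K * z (K + 1) with hw2
  set w3 : ℤ := x K * y (K + 1) - y K * x (K + 1) with hw3
  have hw3pos : 0 < w3 := h.q_pos K
  have key : ∀ i ≤ K, ∀ j < 3, 0 ≤ x (K - i + j) * w1 + y (K - i + j) * w2 + z (K - i + j) * w3 := by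
    intro i
    induction i with
    | zero =>
      intro _ j hj
      interval_cases j
      · refine le_of_eq ?_
        simp only [Nat.sub_zero, add_zero, hw1, hw2, hw3]
        ring
      · refine le_of_eq ?_
        simp only [Nat.sub_zero, hw1, hw2, hw3]
        ring
      · refine zero_le_one.trans (le_of_eq ?_)
        simp only [Nat.sub_zero, hw1, hw2, hw3]
        linear_combination (-1) * h.det_eq_one K
    | succ i ih =>
      intro hi j hj
      obtain ⟨l, hl⟩ : ∃ l, K - i = l + 1 := ⟨K - i - 1, by omega⟩
      have hl' : K - (i + 1) = l := by omega
      rw [hl'] at *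
      have ih' := ih (by omega)
      rw [hl] at ih'
      interval_cases j
      · have a0 := ih' 0 (by norm_num)
        have a2 := ih' 2 (by norm_num)
        rw [show l + 1 + 2 = l + 3 from rfl, h.hx, h.hy, h.hz] at a2
        have : (0 : ℤ) ≤ s l * (x (l + 1 + 0) * w1 + y (l + 1 + 0) * w2 + z (l + 1 + 0) * w3) := by
          positivity
        simp only [add_zero] at this ⊢
        linarith
      · exact ih' 0 (by norm_num)
      · exact ih' 1 (by norm_num)
  have all : ∀ k ≤ K, 0 ≤ x k * w1 + y k * w2 + z k * w3 := by
    intro k hk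
    have := key (K - k) (by omega) 0 (by norm_num)
    rwa [show K - (K - k) + 0 = k by omega] at this
  have k0 := key K le_rfl 0 (by norm_num)
  have k1 := key K le_rfl 1 (by norm_num)
  have k2 := key K le_rfl 2 (by norm_num)
  simp only [Nat.sub_self, zero_add, h.x0, h.x1, h.x2, h.y0, h.y1, h.y2, h.z0, h.z1, h.z2] at k0 k1 k2
  have hr : (0 : ℝ) < w3 := by exact_mod_cast hw3pos
  have r1 : (0 : ℝ) ≤ w1 := by exact_mod_cast (by linarith : (0 : ℤ) ≤ w1)
  have r2 : (0 : ℝ) ≤ w2 := by exact_mod_cast (by linarith : (0 : ℤ) ≤ w2)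
  have r3 : (w1 : ℝ) + w2 ≤ w3 := by exact_mod_cast (by linarith : w1 + w2 ≤ w3)
  refine ⟨w1 / w3, w2 / w3, by positivity, by positivity, ?_, ?_, fun k hk => ?_⟩
  · rw [div_le_one hr]; linarith
  · rw [div_le_one hr]; linarith
  · have : (0 : ℝ) ≤ x k * w1 + y k * w2 + z k * w3 := by exact_mod_cast all k hk
    have e : (x k : ℝ) * (w1 / w3) + y k * (w2 / w3) + z k
        = (x k * w1 + y k * w2 + z k * w3) / w3 := by field_simp
    rw [e]
    positivity

/-- The planes' half-spaces determined by a chain have a common point. -/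
lemma exists_nonneg (h : IsChain3 x y z s) :
    ∃ α β : ℝ, ∀ k, 0 ≤ x k * α + y k * β + z k := by
  let S : ℕ → Set (ℝ × ℝ) := fun K => (Set.Icc 0 1 ×ˢ Set.Icc 0 1) ∩
    {p | ∀ k ≤ K, 0 ≤ x k * p.1 + y k * p.2 + z k}
  have hcl : ∀ K, IsClosed (S K) := by
    intro K
    refine (isClosed_Icc.prod isClosed_Icc).inter ?_
    simp only [Set.ofPred_forall]
    refine isClosed_iInter fun k => isClosed_iInter fun _ => isClosed_le continuous_const ?_
    fun_prop
  obtain ⟨p, hp⟩ := IsCompact.nonempty_iInter_of_sequence_nonempty_isCompact_isClosed S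
    (fun i p hp => ⟨hp.1, fun k hk => hp.2 k (by omega)⟩)
    (fun K => by
      obtain ⟨α, β, h1, h2, h3, h4, h5⟩ := h.exists_nonneg_upto K
      exact ⟨(α, β), ⟨⟨h1, h3⟩, ⟨h2, h4⟩⟩, h5⟩)
    ((isCompact_Icc.prod isCompact_Icc).of_isClosed_subset (hcl 0) Set.inter_subset_left) hcl
  exact ⟨p.1, p.2, fun k => (Set.mem_iInter.1 hp k).2 k le_rfl⟩

lemma identity (h : IsChain3 x y z s) (α β : ℝ) (k : ℕ) :
    (x (k + 1) * α + y (k + 1) * β + z (k + 1)) * q x y (k + 2)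
      + (x (k + 2) * α + y (k + 2) * β + z (k + 2)) * q x y k
      + (x (k + 3) * α + y (k + 3) * β + z (k + 3)) * q x y (k + 1) = 1 := by
  have hd : ((x k * (y (k + 1) * z (k + 2) - z (k + 1) * y (k + 2))
      - y k * (x (k + 1) * z (k + 2) - z (k + 1) * x (k + 2))
      + z k * (x (k + 1) * y (k + 2) - y (k + 1) * x (k + 2)) : ℤ) : ℝ) = 1 := by
    rw [h.det_eq_one k, Int.cast_one]
  simp only [q]
  rw [show k + 2 + 1 = k + 3 from rfl, show k + 1 + 1 = k + 2 from rfl, h.hx, h.hy, h.hz]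
  push_cast at hd ⊢
  linear_combination hd

end IsChain3

/-- `M` is a norm on the plane, and `C` bounds the area form in terms of `M`. -/
structure IsPlaneNorm (M : ℝ → ℝ → ℝ) (C : ℝ) : Prop where
  C_pos : 0 < C
  pos : ∀ x y, (x ≠ 0 ∨ y ≠ 0) → 0 < M x y
  smul : ∀ a x y, M (a * x) (a * y) = |a| * M x y
  add : ∀ x y x' y', M (x + x') (y + y') ≤ M x y + M x' y'
  area : ∀ x y x' y', |x * y' - y * x'| ≤ C * M x y * M x' y'

namespace IsPlaneNorm

variable {M : ℝ → ℝ → ℝ} {C : ℝ}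

lemma exists_heightData (hM : IsPlaneNorm M C) {p : ℕ} {c : ℝ} (hc : 0 < c)
    (hsmall : 2 * c * C ≤ M (-1) (-1) ^ (p + 1)) :
    ∃ (x y z : ℕ → ℤ) (s : ℕ → ℕ) (α β : ℝ), IsChain3 x y z s ∧
      HeightData p c C (fun k => M (x k) (y k)) (fun k => x k * α + y k * β + z k)
        (fun k => IsChain3.q x y k) := by
  obtain ⟨x, y, z, s, h, hs⟩ := exists_isChain3 fun a b a' b' =>
    ⌈M a' b' ^ (p + 3) / (c * ((a * b' - b * a' : ℤ) : ℝ))⌉₊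
  obtain ⟨α, β, hL⟩ := h.exists_nonneg
  have hq : ∀ k, (0 : ℝ) < IsChain3.q x y k := fun k => by exact_mod_cast h.q_pos k
  have hX : ∀ k, 0 < M (x k) (y k) := by
    intro k
    refine hM.pos _ _ ?_
    by_contra! h0
    have h1 : x k = 0 := by exact_mod_cast h0.1
    have h2 : y k = 0 := by exact_mod_cast h0.2
    have := h.q_pos k
    simp [IsChain3.q, h1, h2] at this
  have hs' : ∀ k, s k = ⌈M (x (k + 2)) (y (k + 2)) ^ (p + 3) / (c * IsChain3.q x y (k + 1))⌉₊ := hs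
  have hs1 : ∀ k, M (x (k + 2)) (y (k + 2)) ^ (p + 3) ≤ c * (s k * IsChain3.q x y (k + 1)) := by
    intro k
    have h1 := Nat.le_ceil (M (x (k + 2)) (y (k + 2)) ^ (p + 3) / (c * IsChain3.q x y (k + 1)))
    rw [← hs', div_le_iff₀ (mul_pos hc (hq _))] at h1
    linarith
  have hs2 : ∀ k, c * (s k * IsChain3.q x y (k + 1))
      ≤ M (x (k + 2)) (y (k + 2)) ^ (p + 3) + c * IsChain3.q x y (k + 1) := by
    intro k
    have hpos := mul_pos hc (hq (k + 1))
    have h1 := Nat.ceil_lt_add_one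
      (a := M (x (k + 2)) (y (k + 2)) ^ (p + 3) / (c * IsChain3.q x y (k + 1)))
      (div_pos (pow_pos (hX _) _) hpos).le
    rw [← hs', ← sub_lt_iff_lt_add, lt_div_iff₀ hpos] at h1
    linarith
  refine ⟨x, y, z, s, α, β, h, ⟨hc, hM.C_pos, hX, hL, hq, fun k => ?_, fun k => ?_, fun k => ?_,
    fun k => ?_, ?_⟩⟩
  · refine le_trans (le_of_eq ?_) ((le_abs_self _).trans (hM.area (x k) (y k) (x (k + 1)) (y (k + 1))))
    simp [IsChain3.q]
  · refine (hs1 k).trans (mul_le_mul_of_nonneg_left ?_ hc.le)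
    cases k with
    | zero =>
      rw [show (0 + 2) = 2 from rfl, h.q_two, h.q_one]
      simp
    | succ k =>
      rw [show k + 1 + 2 = k + 3 from rfl, show k + 1 + 1 = k + 2 from rfl, h.q_rec k]
      push_cast
      linarith [hq k]
  · have h1 := hs2 (k + 1)
    rw [show k + 1 + 2 = k + 3 from rfl, show k + 1 + 1 = k + 2 from rfl] at h1
    rw [h.q_rec k]
    push_cast
    linarith
  · exact h.identity α β k
  · simpa [h.x2, h.y2] using hsmall

lemma lower_bound (hM : IsPlaneNorm M C) {p : ℕ} {c α β : ℝ} {x y z : ℕ → ℤ} {s : ℕ → ℕ}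
    (h : IsChain3 x y z s)
    (hd : HeightData p c C (fun k => M (x k) (y k)) (fun k => x k * α + y k * β + z k)
        (fun k => IsChain3.q x y k)) {θ : ℝ} (hθ1 : θ < 1) :
    ∀ᶠ k in atTop, ∀ a b d : ℤ, (a ≠ 0 ∨ b ≠ 0) → M a b ≤ θ * M (x (k + 1)) (y (k + 1)) →
      θ * (x k * α + y k * β + z k) ≤ |a * α + b * β + d| := by
  have hε : 0 < (1 - θ) / 2 := by linarith
  have hle : ∀ᶠ k in atTop, M (x k) (y k) ≤ M (x (k + 1)) (y (k + 1)) :=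
    eventually_atTop.2 ⟨2, fun k hk => by
      obtain ⟨j, rfl⟩ := Nat.exists_eq_add_of_le' hk
      exact hd.le_succ j⟩
  filter_upwards [hle, hd.eventually_L_small hε, hd.eventually_L_small one_pos,
    hd.eventually_L_mul_sq (3 * C)] with k hX hL hL1 hsq a b d hab hMab
  have x0 := hd.X_pos k
  have x1 := hd.X_pos (k + 1)
  have l0 := hd.L_nonneg k
  have l1 := hd.L_nonneg (k + 1)
  have hC := hM.C_pos
  have hMpos : 0 < M a b := hM.pos _ _ (by exact_mod_cast hab)
  have hQ := hd.Q_le k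
  have hQ0 := hd.Q_pos k
  set X0 := M (x k) (y k) with hX0
  set X1 := M (x (k + 1)) (y (k + 1)) with hX1
  set L0 : ℝ := x k * α + y k * β + z k with hL0
  set L1 : ℝ := x (k + 1) * α + y (k + 1) * β + z (k + 1) with hL1'
  set Λ : ℝ := a * α + b * β + d with hΛ
  have hMX : M a b ≤ X1 := hMab.trans (by nlinarith)
  by_contra! hcon
  have hθL : θ * L0 ≤ L0 := by nlinarith
  by_cases hΔ : a * (y k * z (k + 1) - z k * y (k + 1)) - b * (x k * z (k + 1) - z k * x (k + 1))
      + d * (x k * y (k + 1) - y k * x (k + 1)) = 0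
  · obtain ⟨m, m', ha, hb, hd'⟩ := h.exists_combination k hΔ
    have hΛ' : Λ = m * L0 + m' * L1 := by
      simp only [hΛ, hL0, hL1', ha, hb, hd']
      push_cast
      ring
    have hm' : |(m' : ℝ)| * X1 ≤ θ * X1 + |(m : ℝ)| * X0 := by
      have e := hM.add a b (-m * x k) (-m * y k)
      rw [hM.smul, abs_neg] at e
      have e2 := hM.smul m' (x (k + 1)) (y (k + 1))
      rw [← hX1] at e2
      rw [← e2]
      refine le_trans (le_of_eq ?_) (e.trans (add_le_add_left hMab _))
      rw [ha, hb]
      push_cast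
      congr 1 <;> ring
    by_cases hm : m = 0
    · have hm'0 : m' = 0 := by
        by_contra hne
        have : (1 : ℝ) ≤ |(m' : ℝ)| := by exact_mod_cast Int.one_le_abs hne
        simp only [hm, Int.cast_zero, abs_zero, zero_mul, add_zero] at hm'
        nlinarith
      simp [hm, hm'0] at ha hb
      tauto
    · have hm1 : (1 : ℝ) ≤ |(m : ℝ)| := by exact_mod_cast Int.one_le_abs hm
      have hm2 : |(m' : ℝ)| ≤ 2 * |(m : ℝ)| := by
        refine le_of_mul_le_mul_right ?_ x1
        nlinarith
      have t1 : |(m : ℝ)| * L0 - |(m' : ℝ)| * L1 ≤ |Λ| := by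
        have := abs_sub_abs_le_abs_sub ((m : ℝ) * L0) (-(m' * L1))
        rw [abs_neg, abs_mul, abs_mul, abs_of_nonneg l0, abs_of_nonneg l1, sub_neg_eq_add,
          ← hΛ'] at this
        exact this
      have t2 : |(m' : ℝ)| * L1 ≤ 2 * |(m : ℝ)| * L1 := mul_le_mul_of_nonneg_right hm2 l1
      have t3 : |(m : ℝ)| * (θ * L0) ≤ |(m : ℝ)| * (L0 - 2 * L1) :=
        mul_le_mul_of_nonneg_left (by linarith) (abs_nonneg _)
      by_cases hθ : 0 ≤ θ * L0
      · nlinarith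
      · linarith [abs_nonneg Λ]
  · have hΔ1 : (1 : ℝ) ≤ |((a * (y k * z (k + 1) - z k * y (k + 1))
        - b * (x k * z (k + 1) - z k * x (k + 1))
        + d * (x k * y (k + 1) - y k * x (k + 1)) : ℤ) : ℝ)| := by
      exact_mod_cast Int.one_le_abs hΔ
    have e : ((a * (y k * z (k + 1) - z k * y (k + 1))
        - b * (x k * z (k + 1) - z k * x (k + 1))
        + d * (x k * y (k + 1) - y k * x (k + 1)) : ℤ) : ℝ)
        = Λ * IsChain3.q x y k + L0 * (x (k + 1) * b - y (k + 1) * a)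
          - L1 * (x k * b - y k * a) := by
      simp only [IsChain3.q, hΛ, hL0, hL1']
      push_cast
      ring
    rw [e] at hΔ1
    have a1 := hM.area (x (k + 1)) (y (k + 1)) a b
    have a2 := hM.area (x k) (y k) a b
    rw [← hX1] at a1
    rw [← hX0] at a2
    have b1 : |Λ * (IsChain3.q x y k : ℝ)| ≤ L0 * (C * X1 ^ 2) := by
      rw [abs_mul, abs_of_pos hQ0]
      refine mul_le_mul (by linarith) (hQ.trans ?_) hQ0.le l0
      rw [mul_assoc, sq]
      gcongr
    have b2 : |L0 * (x (k + 1) * b - y (k + 1) * a)| ≤ L0 * (C * X1 ^ 2) := by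
      rw [abs_mul, abs_of_nonneg l0]
      refine mul_le_mul_of_nonneg_left (a1.trans ?_) l0
      rw [mul_assoc, sq]
      gcongr
    have b3 : |L1 * (x k * b - y k * a)| ≤ L0 * (C * X1 ^ 2) := by
      rw [abs_mul, abs_of_nonneg l1]
      refine mul_le_mul (by linarith) (a2.trans ?_) (abs_nonneg _) l0
      rw [mul_assoc, sq]
      gcongr
    have t1 := abs_sub (Λ * (IsChain3.q x y k : ℝ) + L0 * (x (k + 1) * b - y (k + 1) * a))
      (L1 * (x k * b - y k * a))
    have t2 := abs_add_le (Λ * (IsChain3.q x y k : ℝ)) (L0 * (x (k + 1) * b - y (k + 1) * a))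
    have t3 : 3 * (L0 * (C * X1 ^ 2)) < 1 := lt_of_eq_of_lt (by ring) hsq
    linarith

end IsPlaneNorm

lemma psiDualN_nonneg (n : ℕ) (N : (Fin n → ℝ) → ℝ) (ξ : Fin n → ℝ) (t : ℝ) :
    0 ≤ psiDualN n N ξ t := by
  refine Real.sInf_nonneg ?_
  rintro r ⟨b, b', -, -, rfl⟩
  exact abs_nonneg _

lemma psiDualN_le {n : ℕ} {N : (Fin n → ℝ) → ℝ} {ξ : Fin n → ℝ} {t : ℝ} (b : Fin n → ℤ) (b' : ℤ)
    (h1 : 1 ≤ N (fun i => (b i : ℝ))) (ht : N (fun i => (b i : ℝ)) ≤ t) :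
    psiDualN n N ξ t ≤ |(∑ i, (b i : ℝ) * ξ i) + (b' : ℝ)| := by
  refine csInf_le ⟨0, ?_⟩ ⟨b, b', h1, ht, rfl⟩
  rintro r ⟨b, b', -, -, rfl⟩
  exact abs_nonneg _

lemma le_psiDualN {n : ℕ} {N : (Fin n → ℝ) → ℝ} {ξ : Fin n → ℝ} {t l : ℝ}
    (hne : ∃ b : Fin n → ℤ, 1 ≤ N (fun i => (b i : ℝ)) ∧ N (fun i => (b i : ℝ)) ≤ t)
    (h : ∀ (b : Fin n → ℤ) (b' : ℤ), 1 ≤ N (fun i => (b i : ℝ)) → N (fun i => (b i : ℝ)) ≤ t →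
      l ≤ |(∑ i, (b i : ℝ) * ξ i) + (b' : ℝ)|) :
    l ≤ psiDualN n N ξ t := by
  obtain ⟨b, h1, h2⟩ := hne
  refine le_csInf ⟨_, b, 0, h1, h2, rfl⟩ ?_
  rintro r ⟨b, b', h1, h2, rfl⟩
  exact h b b' h1 h2

lemma eventually_pow_mul_psiDualN_nonneg (n : ℕ) (N : (Fin n → ℝ) → ℝ) (ξ : Fin n → ℝ) :
    ∀ᶠ t : ℝ in atTop, 0 ≤ t ^ n * psiDualN n N ξ t := by
  filter_upwards [eventually_ge_atTop 0] with t ht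
  exact mul_nonneg (pow_nonneg ht n) (psiDualN_nonneg n N ξ t)

/-- If the integer vectors `(b k, z k)` realize `ψ_ξ` well enough, then `ξ ∈ FS_n(‖·‖, c)`. -/
lemma mem_FSdualN_of_approximations {n : ℕ} (hn : n ≠ 0) {N : (Fin n → ℝ) → ℝ} {ξ : Fin n → ℝ}
    {c : ℝ} (hc : 0 < c) (b : ℕ → Fin n → ℤ) (z : ℕ → ℤ) (X L : ℕ → ℝ)
    (hX : ∀ k, N (fun i => (b k i : ℝ)) = X k)
    (hL : ∀ k, |(∑ i, (b k i : ℝ) * ξ i) + (z k : ℝ)| = L k)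
    (hXtop : Tendsto X atTop atTop)
    (hratio : Tendsto (fun k => X k / X (k + 1)) atTop (𝓝 0))
    (hlim : Tendsto (fun k => X (k + 1) ^ n * L k) atTop (𝓝 c))
    (hmin : ∀ θ : ℝ, 0 < θ → θ < 1 → ∃ᶠ k in atTop, ∀ (a : Fin n → ℤ) (a' : ℤ),
      1 ≤ N (fun i => (a i : ℝ)) → N (fun i => (a i : ℝ)) ≤ θ * X (k + 1) →
      θ * L k ≤ |(∑ i, (a i : ℝ) * ξ i) + (a' : ℝ)|) :
    ξ ∈ FSdualN n N c := by
  have hnn := eventually_pow_mul_psiDualN_nonneg n N ξ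
  have hX1 : ∀ᶠ k in atTop, 1 ≤ X k := hXtop.eventually_ge_atTop 1
  have hXtop1 : Tendsto (fun k => X (k + 1)) atTop atTop := (tendsto_add_atTop_iff_nat 1).2 hXtop
  have hle : ∀ ε > 0, ∀ᶠ t : ℝ in atTop, t ^ n * psiDualN n N ξ t ≤ c + ε := by
    intro ε hε
    have h1 := hlim.eventually (ge_mem_nhds (show c < c + ε by linarith))
    obtain ⟨K, hK⟩ := eventually_atTop.1 (h1.and hX1)
    filter_upwards [eventually_ge_atTop (X K), eventually_ge_atTop 0] with t ht ht0
    have hex : ∃ j, K < j ∧ t < X j :=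
      ((eventually_gt_atTop K).and (hXtop.eventually_gt_atTop t)).exists
    classical
    obtain ⟨hj1, hj2⟩ := Nat.find_spec hex
    have hlast := Nat.find_min hex (m := Nat.find hex - 1) (by omega)
    set j := Nat.find hex with hj
    obtain ⟨i, hi⟩ : ∃ i, j = i + 1 := ⟨j - 1, by omega⟩
    rw [hi] at hj1 hj2 hlast
    simp only [Nat.add_sub_cancel] at hlast
    have hit : X i ≤ t := by
      rcases (Nat.lt_succ_iff.1 hj1).eq_or_lt with rfl | hlt
      · exact ht
      · by_contra! hcon
        exact hlast ⟨hlt, hcon⟩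
    obtain ⟨k1, k2⟩ := hK i (Nat.lt_succ_iff.1 hj1)
    have hpsi := psiDualN_le (N := N) (ξ := ξ) (t := t) (b i) (z i) (by rwa [hX]) (by rwa [hX])
    rw [hL] at hpsi
    calc t ^ n * psiDualN n N ξ t ≤ X (i + 1) ^ n * L i :=
          mul_le_mul (pow_le_pow_left₀ ht0 hj2.le n) hpsi (psiDualN_nonneg _ _ _ _)
            (pow_nonneg (ht0.trans hj2.le) n)
      _ ≤ _ := k1
  have hbdd : IsBoundedUnder (· ≤ ·) atTop fun t : ℝ => t ^ n * psiDualN n N ξ t :=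
    ⟨c + 1, eventually_map.2 (hle 1 one_pos)⟩
  have hbdd' : IsBoundedUnder (· ≥ ·) atTop fun t : ℝ => t ^ n * psiDualN n N ξ t :=
    ⟨0, eventually_map.2 hnn⟩
  refine ⟨le_antisymm ?_ ?_, ?_⟩
  · exact le_of_forall_pos_le_add fun ε hε => limsup_le_of_le hbdd'.isCoboundedUnder_le (hle ε hε)
  · have hθ : Tendsto (fun θ : ℝ => θ ^ n * (θ * (θ * c))) (𝓝[<] 1) (𝓝 c) := by
      have : Continuous fun θ : ℝ => θ ^ n * (θ * (θ * c)) := by fun_prop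
      simpa using (this.tendsto 1).mono_left nhdsWithin_le_nhds
    have hpos : ∀ᶠ θ : ℝ in 𝓝[<] 1, 0 < θ :=
      nhdsWithin_le_nhds (lt_mem_nhds one_pos)
    refine le_of_tendsto hθ ?_
    filter_upwards [hpos, self_mem_nhdsWithin] with θ h0 h1
    have h1 : θ < 1 := h1
    refine le_limsup_of_frequently_le ?_ hbdd
    refine (hXtop1.const_mul_atTop h0).frequently ?_
    have e1 := hlim.eventually (lt_mem_nhds (show θ * c < c by nlinarith))
    have e2 := hratio.eventually (gt_mem_nhds h0)
    refine ((hmin θ h0 h1).and_eventually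
      ((e1.and e2).and (hX1.and (hXtop1.eventually_ge_atTop 1)))).mono ?_
    rintro k ⟨hk, ⟨k1, k2⟩, k3, k4⟩
    have hpos : 0 < X (k + 1) := by linarith
    rw [div_lt_iff₀ hpos] at k2
    have hpsi := le_psiDualN (N := N) (ξ := ξ) (t := θ * X (k + 1)) ⟨b k, by rwa [hX], by rw [hX]; exact k2.le⟩ hk
    calc θ ^ n * (θ * (θ * c)) ≤ θ ^ n * (θ * (X (k + 1) ^ n * L k)) := by gcongr
      _ = (θ * X (k + 1)) ^ n * (θ * L k) := by ring
      _ ≤ _ := mul_le_mul_of_nonneg_left hpsi (by positivity)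
  · simp only [Set.mem_ofPred_eq, not_lt]
    refine le_of_forall_pos_le_add fun ε hε => liminf_le_of_frequently_le ?_ hbdd'
    refine hXtop.frequently (Eventually.frequently ?_)
    have h2 : Tendsto (fun k => (X k / X (k + 1)) ^ n * (X (k + 1) ^ n * L k)) atTop (𝓝 0) := by
      have := (hratio.pow n).mul hlim
      simpa [hn] using this
    filter_upwards [h2.eventually (gt_mem_nhds hε), hX1, hXtop1.eventually_ge_atTop 1] with k k1 k2 k3
    have hpsi := psiDualN_le (N := N) (ξ := ξ) (t := X k) (b k) (z k) (by rwa [hX]) (hX k).le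
    rw [hL] at hpsi
    have hpos : 0 < X (k + 1) := by linarith
    calc X k ^ n * psiDualN n N ξ (X k) ≤ X k ^ n * L k :=
          mul_le_mul_of_nonneg_left hpsi (by positivity)
      _ = (X k / X (k + 1)) ^ n * (X (k + 1) ^ n * L k) := by rw [div_pow]; field_simp
      _ ≤ 0 + ε := by linarith

/-- Vectors with vanishing first coordinate lie in `FS_n(‖·‖, 0)`. -/
lemma mem_FSdualN_zero {n : ℕ} {N : (Fin n → ℝ) → ℝ} (hN : IsNorm N) {ξ : Fin n → ℝ} {j : Fin n}
    (hj : ξ j = 0) : ξ ∈ FSdualN n N 0 := by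
  have hpos : 0 < N (Pi.single j 1) := by
    refine lt_of_le_of_ne (hN.nonneg _) fun h => ?_
    have := congrFun ((hN.1 _).1 h.symm) j
    simp at this
  obtain ⟨r, hr⟩ := exists_nat_gt (N (Pi.single j 1))⁻¹
  have hr0 : (0 : ℝ) < r := (inv_pos.2 hpos).trans hr
  have hNb : N (fun i => ((Pi.single j (r : ℤ) : Fin n → ℤ) i : ℝ)) = r * N (Pi.single j 1) := by
    have e : (fun i => ((Pi.single j (r : ℤ) : Fin n → ℤ) i : ℝ)) = (r : ℝ) • Pi.single j (1 : ℝ) := by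
      funext i
      by_cases h : i = j
      · subst h; simp
      · simp [h]
    rw [e, hN.2.1, abs_of_pos hr0]
  have hev : (fun t : ℝ => t ^ n * psiDualN n N ξ t) =ᶠ[atTop] fun _ => 0 := by
    filter_upwards [eventually_ge_atTop (r * N (Pi.single j 1))] with t ht
    have h := psiDualN_le (N := N) (ξ := ξ) (t := t) (Pi.single j (r : ℤ)) 0
      (by rw [hNb]; exact ((inv_lt_iff_one_lt_mul₀ hpos).1 hr).le) (by rwa [hNb])
    have hs : ∑ i, ((Pi.single j (r : ℤ) : Fin n → ℤ) i : ℝ) * ξ i = 0 := by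
      refine Finset.sum_eq_zero fun i _ => ?_
      by_cases h : i = j
      · subst h; simp [hj]
      · simp [h]
    rw [hs] at h
    simp only [Int.cast_zero, add_zero, abs_zero] at h
    rw [le_antisymm h (psiDualN_nonneg _ _ _ _), mul_zero]
  constructor
  · change limsup _ _ = 0
    rw [limsup_congr hev, limsup_const]
  · simp only [Set.mem_ofPred_eq, ThetaTildeDualN]
    rw [liminf_congr hev, liminf_const]
    exact lt_irrefl 0

lemma IsNorm.isPlaneNorm {m : ℕ} {N : (Fin (m + 2) → ℝ) → ℝ} (hN : IsNorm N) {κ : ℝ} (hκ : 0 < κ)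
    (hle : ∀ x, κ * ‖x‖ ≤ N x) :
    IsPlaneNorm (fun x y => N (Matrix.vecCons x (Matrix.vecCons y 0))) (2 / κ ^ 2) where
  C_pos := by positivity
  pos x y h := by
    refine lt_of_le_of_ne (hN.nonneg _) fun h0 => ?_
    have h1 := (hN.1 _).1 h0.symm
    have hx := congrFun h1 0
    have hy := congrFun h1 1
    simp at hx hy
    tauto
  smul a x y := by
    rw [← hN.2.1]
    simp
  add x y x' y' := by
    refine le_trans (le_of_eq ?_) (hN.2.2 _ _)
    simp
  area x y x' y' := by
    have hx : ∀ x y : ℝ, |x| ≤ N (Matrix.vecCons x (Matrix.vecCons y 0)) / κ := fun x y => by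
      rw [le_div_iff₀' hκ]
      refine le_trans (mul_le_mul_of_nonneg_left ?_ hκ.le) (hle _)
      simpa using norm_le_pi_norm (Matrix.vecCons x (Matrix.vecCons y (0 : Fin m → ℝ))) 0
    have hy : ∀ x y : ℝ, |y| ≤ N (Matrix.vecCons x (Matrix.vecCons y 0)) / κ := fun x y => by
      rw [le_div_iff₀' hκ]
      refine le_trans (mul_le_mul_of_nonneg_left ?_ hκ.le) (hle _)
      simpa using norm_le_pi_norm (Matrix.vecCons x (Matrix.vecCons y (0 : Fin m → ℝ))) 1
    set A := N (Matrix.vecCons x (Matrix.vecCons y 0))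
    set B := N (Matrix.vecCons x' (Matrix.vecCons y' 0))
    have hA : 0 ≤ A := hN.nonneg _
    calc |x * y' - y * x'| ≤ |x * y'| + |y * x'| := abs_sub _ _
      _ = |x| * |y'| + |y| * |x'| := by rw [abs_mul, abs_mul]
      _ ≤ A / κ * (B / κ) + A / κ * (B / κ) := by
        gcongr
        · exact hx x y
        · exact hy x' y'
        · exact hy x y
        · exact hx x' y'
      _ = 2 / κ ^ 2 * A * B := by field_simp; ring

lemma sum_vecCons_vecCons {m : ℕ} (b : Fin (m + 2) → ℤ) (α β : ℝ) (η : Fin m → ℝ) :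
    ∑ i, (b i : ℝ) * (Matrix.vecCons α (Matrix.vecCons β η) : Fin (m + 2) → ℝ) i
      = b 0 * α + b 1 * β + ∑ i : Fin m, (b i.succ.succ : ℝ) * η i := by
  rw [Fin.sum_univ_succ, Fin.sum_univ_succ]
  simp [add_assoc]

/-- The measure of those `η` in the unit cube for which some integer vector of height at most `R`,
not supported on the first two coordinates, has a linear form value at most `δ`. -/
lemma cubeMeasure_small_forms_le {m : ℕ} {N : (Fin (m + 2) → ℝ) → ℝ} {κ : ℝ} (hκ : 0 < κ)
    (hle : ∀ x, κ * ‖x‖ ≤ N x) (α β : ℝ) {R δ : ℝ} (hR : κ ≤ R) (hδ : 0 ≤ δ) :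
    cubeMeasure m {η | ∃ (b : Fin (m + 2) → ℤ) (b' : ℤ), (fun i : Fin m => b i.succ.succ) ≠ 0 ∧
      N (fun i => (b i : ℝ)) ≤ R ∧
      |(∑ i, (b i : ℝ) * (Matrix.vecCons α (Matrix.vecCons β η) : Fin (m + 2) → ℝ) i) + b'| ≤ δ}
      ≤ ENNReal.ofReal (2 * (3 / κ) ^ (m + 2) * (R ^ (m + 2) * δ)) := by
  classical
  set J : ℕ := ⌊R / κ⌋₊ with hJ
  have hRκ : 1 ≤ R / κ := (one_le_div hκ).2 hR
  set S : Finset (Fin (m + 2) → ℤ) :=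
    (Fintype.piFinset fun _ => Finset.Icc (-(J : ℤ)) J).filter
      fun b => (fun i : Fin m => b i.succ.succ) ≠ 0 with hS
  have hcard : (S.card : ℝ) ≤ (3 / κ) ^ (m + 2) * R ^ (m + 2) := by
    have h1 : S.card ≤ (2 * J + 1) ^ (m + 2) := by
      refine (Finset.card_filter_le _ _).trans (le_of_eq ?_)
      rw [Fintype.card_piFinset_const, Int.card_Icc]
      congr 1
      omega
    have h2 : ((2 * J + 1 : ℕ) : ℝ) ≤ 3 / κ * R := by
      have := Nat.floor_le (zero_le_one.trans hRκ)
      push_cast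
      rw [div_mul_eq_mul_div, mul_div_assoc]
      linarith
    calc (S.card : ℝ) ≤ ((2 * J + 1 : ℕ) : ℝ) ^ (m + 2) := by exact_mod_cast h1
      _ ≤ (3 / κ * R) ^ (m + 2) := pow_le_pow_left₀ (Nat.cast_nonneg _) h2 _
      _ = _ := mul_pow _ _ _
  calc _ ≤ cubeMeasure m (⋃ b ∈ S, {η | ∃ b' : ℤ,
          |∑ i : Fin m, (b i.succ.succ : ℝ) * η i + (b 0 * α + b 1 * β) + b'| ≤ δ}) := by
        refine measure_mono ?_
        rintro η ⟨b, b', hb0, hbR, hb⟩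
        refine Set.mem_biUnion (x := b) ?_ ⟨b', ?_⟩
        · rw [Finset.mem_coe, hS, Finset.mem_filter, Fintype.mem_piFinset]
          refine ⟨fun i => ?_, hb0⟩
          have h1 : |(b i : ℝ)| ≤ R / κ := by
            rw [le_div_iff₀' hκ]
            refine le_trans (mul_le_mul_of_nonneg_left ?_ hκ.le) ((hle _).trans hbR)
            exact norm_le_pi_norm (fun i => (b i : ℝ)) i
          have h2 : (b i).natAbs ≤ J := by
            rw [hJ, Nat.le_floor_iff (zero_le_one.trans hRκ), Nat.cast_natAbs, Int.cast_abs]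
            exact h1
          rw [Finset.mem_Icc]
          omega
        · rw [sum_vecCons_vecCons] at hb
          rwa [add_comm (∑ i : Fin m, _)]
    _ ≤ ∑ b ∈ S, ENNReal.ofReal (2 * δ) := by
        refine (measure_biUnion_finset_le _ _).trans (Finset.sum_le_sum fun b hb => ?_)
        exact cubeMeasure_near_integer_le (Finset.mem_filter.1 hb).2 _ _
    _ = ENNReal.ofReal (S.card * (2 * δ)) := by
        rw [Finset.sum_const, nsmul_eq_mul, ENNReal.ofReal_mul (Nat.cast_nonneg _),
          ENNReal.ofReal_natCast]
    _ ≤ _ := by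
        refine ENNReal.ofReal_le_ofReal ?_
        calc (S.card : ℝ) * (2 * δ) ≤ ((3 / κ) ^ (m + 2) * R ^ (m + 2)) * (2 * δ) :=
              mul_le_mul_of_nonneg_right hcard (by linarith)
          _ = _ := by ring

/-- If `A` contains a copy `{(α, β)} × F` of a set `F` then `dim_H F ≤ dim_H A`. -/
lemma dimH_le_of_vecCons_mem {m : ℕ} {F : Set (Fin m → ℝ)} {A : Set (Fin (m + 2) → ℝ)} {α β : ℝ}
    (h : ∀ η ∈ F, Matrix.vecCons α (Matrix.vecCons β η) ∈ A) : dimH F ≤ dimH A := by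
  have hlip : LipschitzWith 1 fun (ξ : Fin (m + 2) → ℝ) (i : Fin m) => ξ i.succ.succ := by
    refine LipschitzWith.of_dist_le_mul fun ξ ξ' => ?_
    rw [NNReal.coe_one, one_mul, dist_pi_le_iff dist_nonneg]
    exact fun i => dist_le_pi_dist ξ ξ' _
  refine le_trans (dimH_mono fun η hη => ?_) (hlip.dimH_image_le A)
  exact ⟨_, h η hη, by funext i; simp⟩

lemma le_dimH_FSdualN_zero {m : ℕ} {N : (Fin (m + 2) → ℝ) → ℝ} (hN : IsNorm N) :
    (m : ℝ≥0∞) ≤ dimH (FSdualN (m + 2) N 0) := by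
  refine le_trans (le_dimH_of_cubeMeasure_ne_zero (F := Set.univ) (by simp))
    (dimH_le_of_vecCons_mem (α := 0) (β := 0) fun η _ => mem_FSdualN_zero hN (j := 0) ?_)
  simp

lemma le_dimH_FSdualN_of_pos {p : ℕ} {N : (Fin (p + 1 + 2) → ℝ) → ℝ} (hN : IsNorm N) {κ : ℝ}
    (hκ : 0 < κ) (hle : ∀ x, κ * ‖x‖ ≤ N x) {c : ℝ} (hc : 0 < c)
    (hsmall : 2 * c * (2 / κ ^ 2) ≤ N (Matrix.vecCons (-1) (Matrix.vecCons (-1) 0)) ^ (p + 1))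
    (hsmall' : 2 * (3 / κ) ^ (p + 3) * c ≤ 1 / 2) :
    ((p + 1 : ℕ) : ℝ≥0∞) ≤ dimH (FSdualN (p + 1 + 2) N c) := by
  have hM := hN.isPlaneNorm hκ hle
  obtain ⟨x, y, z, s, α, β, h, hd⟩ := hM.exists_heightData hc hsmall
  let b : ℕ → Fin (p + 1 + 2) → ℤ := fun k => Matrix.vecCons (x k) (Matrix.vecCons (y k) 0)
  have hcast : ∀ u v : ℤ, (fun i => ((Matrix.vecCons u (Matrix.vecCons v 0) :
      Fin (p + 1 + 2) → ℤ) i : ℝ)) = Matrix.vecCons (u : ℝ) (Matrix.vecCons (v : ℝ) 0) := by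
    intro u v
    funext i
    refine Fin.cases (by simp) (fun i => Fin.cases (by simp) (fun i => by simp) i) i
  let X : ℕ → ℝ := fun k => N (Matrix.vecCons (x k : ℝ) (Matrix.vecCons (y k : ℝ) 0))
  let L : ℕ → ℝ := fun k => x k * α + y k * β + z k
  let E : ℕ → Set (Fin (p + 1) → ℝ) := fun k =>
    {η | ∃ (b : Fin (p + 1 + 2) → ℤ) (b' : ℤ), (fun i : Fin (p + 1) => b i.succ.succ) ≠ 0 ∧
      N (fun i => (b i : ℝ)) ≤ X (k + 1) ∧
      |(∑ i, (b i : ℝ) * (Matrix.vecCons α (Matrix.vecCons β η) : Fin (p + 1 + 2) → ℝ) i) + b'|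
        ≤ L k}
  have hX : Tendsto X atTop atTop := hd.tendsto_X
  have hE : ∀ᶠ k in atTop, cubeMeasure (p + 1) (E k) ≤ ENNReal.ofReal (1 / 2) := by
    rw [← map_add_atTop_eq_nat 1, eventually_map]
    filter_upwards [((tendsto_add_atTop_iff_nat 2).2 hX).eventually_ge_atTop κ] with k hk
    refine (cubeMeasure_small_forms_le hκ hle α β hk (hd.L_nonneg (k + 1))).trans
      (ENNReal.ofReal_le_ofReal (le_trans ?_ hsmall'))
    exact mul_le_mul_of_nonneg_left (hd.pow_mul_L_le k) (by positivity)
  have hF := measure_frequently_notMem_ne_zero (cubeMeasure (p + 1)) E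
    (by rw [ENNReal.ofReal_lt_one]; norm_num) hE
  refine (le_dimH_of_cubeMeasure_ne_zero hF).trans
    (dimH_le_of_vecCons_mem (α := α) (β := β) fun η hη => ?_)
  refine mem_FSdualN_of_approximations (by omega) hc b z X L (fun k => ?_) (fun k => ?_) hX
    hd.tendsto_ratio hd.tendsto_pow_mul_L fun θ hθ0 hθ1 => ?_
  · simp only [b, X, hcast]
  · rw [sum_vecCons_vecCons]
    refine Eq.trans ?_ (abs_of_nonneg (hd.L_nonneg k))
    simp [b, L]
  · have hη' : ∃ᶠ k in atTop, η ∉ E k := hη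
    refine (hη'.and_eventually (hM.lower_bound h hd hθ1)).mono ?_
    rintro k ⟨hk1, hk2⟩ a a' ha1 haX
    have hXk : 0 < X (k + 1) := hd.X_pos (k + 1)
    by_cases ha : (fun i : Fin (p + 1) => a i.succ.succ) = 0
    · have ha' : a = Matrix.vecCons (a 0) (Matrix.vecCons (a 1) 0) := by
        funext i
        refine Fin.cases (by simp) (fun i => Fin.cases (by simp) (fun i => ?_) i) i
        simpa using congrFun ha i
      have hsum : ∑ i, (a i : ℝ) * (Matrix.vecCons α (Matrix.vecCons β η) :
          Fin (p + 1 + 2) → ℝ) i = a 0 * α + a 1 * β := by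
        rw [sum_vecCons_vecCons, add_eq_left]
        refine Finset.sum_eq_zero fun i _ => ?_
        have := congrFun ha i
        simp only [Pi.zero_apply] at this
        simp [this]
      rw [hsum]
      rw [ha', hcast] at ha1 haX
      refine hk2 (a 0) (a 1) a' ?_ haX
      by_contra! h0
      have hz : (Matrix.vecCons ((0 : ℤ) : ℝ) (Matrix.vecCons ((0 : ℤ) : ℝ) 0) :
          Fin (p + 1 + 2) → ℝ) = 0 := by simp
      rw [h0.1, h0.2, hz, (hN.1 0).2 rfl] at ha1
      linarith
    · by_contra! hcon
      refine hk1 ⟨a, a', ha, haX.trans (by nlinarith), hcon.le.trans ?_⟩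
      have : 0 ≤ L k := hd.L_nonneg k
      change θ * L k ≤ L k
      nlinarith

/-- for `n ≥ 4` and any norm `‖·‖` on `ℝⁿ` there is `c_n = c_n(‖·‖) > 0`
such that `dim_H FS_n(‖·‖,c) ≥ n − 2` for every `c ∈ [0, c_n]`; in particular the
Dirichlet spectrum `{Θ(‖·‖,ξ) : ξ ∈ ℝⁿ}` contains some right neighborhood of `0`. -/
theorem dimH_FSdualN_ge (n : ℕ) (hn : 4 ≤ n)
    (N : (Fin n → ℝ) → ℝ) (hN : IsNorm N) :
    ∃ cn : ℝ, 0 < cn ∧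
      (∀ c : ℝ, 0 ≤ c → c ≤ cn →
        ((n - 2 : ℕ) : ℝ≥0∞) ≤ dimH (FSdualN n N c)) ∧
      ∃ ε : ℝ, 0 < ε ∧
        Set.Icc (0 : ℝ) ε ⊆ {y : ℝ | ∃ ξ : Fin n → ℝ, ThetaDualN n N ξ = y} := by
  obtain ⟨p, rfl⟩ : ∃ p, n = p + 1 + 2 := ⟨n - 3, by omega⟩
  obtain ⟨κ, hκ, hle⟩ := hN.exists_pos_mul_norm_le
  have hM := hN.isPlaneNorm hκ hle
  have hpos : 0 < N (Matrix.vecCons (-1) (Matrix.vecCons (-1) 0)) := hM.pos _ _ (by norm_num)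
  set A := N (Matrix.vecCons (-1) (Matrix.vecCons (-1) 0)) ^ (p + 1) with hA
  have hApos : 0 < A := pow_pos hpos _
  set cn := min (A / (2 * (2 / κ ^ 2))) (1 / 2 / (2 * (3 / κ) ^ (p + 3))) with hcn
  have hdim : ∀ c : ℝ, 0 ≤ c → c ≤ cn →
      ((p + 1 + 2 - 2 : ℕ) : ℝ≥0∞) ≤ dimH (FSdualN (p + 1 + 2) N c) := by
    intro c hc0 hc
    rw [Nat.add_sub_cancel]
    rcases hc0.eq_or_lt with rfl | hc0
    · exact le_dimH_FSdualN_zero hN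
    · have h1 := hc.trans (min_le_left _ _)
      have h2 := hc.trans (min_le_right _ _)
      rw [le_div_iff₀ (by positivity)] at h1 h2
      exact le_dimH_FSdualN_of_pos hN hκ hle hc0 (by linarith) (by linarith)
  have hcn0 : 0 < cn := lt_min (by positivity) (by positivity)
  refine ⟨cn, hcn0, hdim, cn, hcn0, fun c hc => ?_⟩
  have hne : (FSdualN (p + 1 + 2) N c).Nonempty := by
    by_contra hempty
    have := hdim c hc.1 hc.2
    rw [Set.not_nonempty_iff_eq_empty.1 hempty, dimH_empty, Nat.add_sub_cancel] at this
    simp at this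
  obtain ⟨ξ, hξ⟩ := hne
  exact ⟨ξ, hξ.1⟩
end

section
/- Let m, n be positive integers such that the unordered pair {m,n} is not {1,1}, not {2,3}, and not {k, k+2} for any integer k ≥ 3. Then the Folklore set FS_{m,n} with respect to the maximum norms is non-empty; moreover dim_H FS_{m,n} ≥ mn − 2·max{m,n}, and the matrices can be chosen of full ℝ-rank min{m,n}. -/
open Filter MeasureTheory
open scoped ENNReal

/-- `ψ_Ω(t)` for `Ω ∈ ℝ^{m×n}` with respect to the maximum norms: the minimum of
`‖Ω·b̂ + b̃‖_∞` over integer vectors `b = (b̂,b̃) ∈ ℤⁿ×ℤᵐ` with `1 ≤ ‖b̂‖_∞ ≤ t`. -/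
noncomputable def psiMax (m n : ℕ) (Ω : Fin m → Fin n → ℝ) (t : ℝ) : ℝ :=
  sInf { r : ℝ | ∃ (bh : Fin n → ℤ) (bt : Fin m → ℤ),
    (∃ i, bh i ≠ 0) ∧ (∀ i, |(bh i : ℝ)| ≤ t) ∧
    r = ⨆ j, |(∑ i, Ω j i * (bh i : ℝ)) + (bt j : ℝ)| }

/-- `Θ(Ω) = limsup_{t→∞} t^{n/m} ψ_Ω(t)`. -/
noncomputable def ThetaMax (m n : ℕ) (Ω : Fin m → Fin n → ℝ) : ℝ :=
  limsup (fun t : ℝ => t ^ ((n : ℝ) / (m : ℝ)) * psiMax m n Ω t) atTop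

/-- `Θ̃(Ω) = liminf_{t→∞} t^{n/m} ψ_Ω(t)`. -/
noncomputable def ThetaTildeMax (m n : ℕ) (Ω : Fin m → Fin n → ℝ) : ℝ :=
  liminf (fun t : ℝ => t ^ ((n : ℝ) / (m : ℝ)) * psiMax m n Ω t) atTop

/-- `FS_{m,n} = Di_{m,n} \ (Bad_{m,n} ∪ Sing_{m,n})` with respect to maximum norms. -/
def FSmax (m n : ℕ) : Set (Fin m → Fin n → ℝ) :=
  {Ω | ThetaMax m n Ω < 1} \
    ({Ω | 0 < ThetaTildeMax m n Ω} ∪ {Ω | ThetaMax m n Ω = 0})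

/-- The distance from `Ω·s` to the nearest integer vector in the maximum norm. -/
noncomputable def integerDist {m n : ℕ} (Ω : Fin m → Fin n → ℝ) (s : Fin n → ℤ) : ℝ :=
  ‖fun i => ((∑ j, Ω i j * (s j : ℝ) : ℝ) : UnitAddCircle)‖

/-- The nonzero integer vectors of maximum norm at most `N + 1`. -/
noncomputable def nonzeroBox (n N : ℕ) : Finset (Fin n → ℤ) :=
  (Fintype.piFinset fun _ => Finset.Icc (-((N : ℤ) + 1)) ((N : ℤ) + 1)).erase 0

lemma mem_nonzeroBox {n N : ℕ} {s : Fin n → ℤ} :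
    s ∈ nonzeroBox n N ↔ s ≠ 0 ∧ ∀ i, |s i| ≤ (N : ℤ) + 1 := by
  simp only [nonzeroBox, Finset.mem_erase, Fintype.mem_piFinset, Finset.mem_Icc, abs_le]

lemma nonzeroBox_nonempty (n N : ℕ) [NeZero n] : (nonzeroBox n N).Nonempty := by
  refine ⟨Pi.single 0 1, mem_nonzeroBox.2 ⟨by simp, fun i => ?_⟩⟩
  by_cases h : i = 0
  · subst h; simp
  · simp [h]; omega

/-- The smallest value of `integerDist Ω` on the nonzero integer vectors of norm at most
`N + 1`. -/
noncomputable def minDist {m n : ℕ} [NeZero n] (Ω : Fin m → Fin n → ℝ) (N : ℕ) : ℝ :=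
  (nonzeroBox n N).inf' (nonzeroBox_nonempty n N) (integerDist Ω)

section minDist

variable {m n : ℕ}

lemma continuous_integerDist (s : Fin n → ℤ) :
    Continuous fun Ω : Fin m → Fin n → ℝ => integerDist Ω s := by
  unfold integerDist
  refine continuous_norm.comp (continuous_pi fun i => ?_)
  refine (AddCircle.continuous_mk' 1).comp ?_
  fun_prop

lemma integerDist_nonneg (Ω : Fin m → Fin n → ℝ) (s : Fin n → ℤ) : 0 ≤ integerDist Ω s :=
  norm_nonneg _

lemma unitAddCircle_norm_le_abs_add (x : ℝ) (k : ℤ) : ‖(x : UnitAddCircle)‖ ≤ |x + k| := by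
  rw [UnitAddCircle.norm_eq]
  have := round_le x (-k)
  push_cast at this
  simpa using this

lemma integerDist_le_iff {Ω : Fin m → Fin n → ℝ} {s : Fin n → ℤ} {ε : ℝ} (hε : 0 ≤ ε) :
    integerDist Ω s ≤ ε ↔
      ∀ i, |(∑ j, Ω i j * (s j : ℝ)) - round (∑ j, Ω i j * (s j : ℝ))| ≤ ε := by
  rw [integerDist, pi_norm_le_iff_of_nonneg hε]
  simp only [UnitAddCircle.norm_eq]

lemma psiMax_nonneg (Ω : Fin m → Fin n → ℝ) (t : ℝ) : 0 ≤ psiMax m n Ω t := by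
  refine Real.sInf_nonneg ?_
  rintro r ⟨bh, bt, -, -, rfl⟩
  exact Real.iSup_nonneg fun _ => abs_nonneg _

variable [NeZero n]

lemma minDist_le {Ω : Fin m → Fin n → ℝ} {N : ℕ} {s : Fin n → ℤ} (hs : s ∈ nonzeroBox n N) :
    minDist Ω N ≤ integerDist Ω s :=
  Finset.inf'_le _ hs

lemma le_minDist_iff {Ω : Fin m → Fin n → ℝ} {N : ℕ} {c : ℝ} :
    c ≤ minDist Ω N ↔ ∀ s ∈ nonzeroBox n N, c ≤ integerDist Ω s :=
  Finset.le_inf'_iff _ _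

lemma exists_integerDist_eq_minDist (Ω : Fin m → Fin n → ℝ) (N : ℕ) :
    ∃ s ∈ nonzeroBox n N, minDist Ω N = integerDist Ω s :=
  Finset.exists_mem_eq_inf' _ _

lemma minDist_nonneg (Ω : Fin m → Fin n → ℝ) (N : ℕ) : 0 ≤ minDist Ω N :=
  le_minDist_iff.2 fun _ _ => integerDist_nonneg _ _

lemma continuous_minDist (N : ℕ) : Continuous fun Ω : Fin m → Fin n → ℝ => minDist Ω N :=
  Continuous.finset_inf'_apply _ fun s _ => continuous_integerDist s

lemma psiMax_le_minDist (Ω : Fin m → Fin n → ℝ) {N : ℕ} {t : ℝ} (ht : (N : ℝ) + 1 ≤ t) :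
    psiMax m n Ω t ≤ minDist Ω N := by
  obtain ⟨s, hs, hmin⟩ := exists_integerDist_eq_minDist Ω N
  obtain ⟨h0, hb⟩ := mem_nonzeroBox.1 hs
  have hmem : (⨆ j, |(∑ i, Ω j i * (s i : ℝ)) +
      ((-round (∑ i, Ω j i * (s i : ℝ)) : ℤ) : ℝ)|) ∈ { r : ℝ | ∃ (bh : Fin n → ℤ) (bt : Fin m → ℤ),
      (∃ i, bh i ≠ 0) ∧ (∀ i, |(bh i : ℝ)| ≤ t) ∧
      r = ⨆ j, |(∑ i, Ω j i * (bh i : ℝ)) + (bt j : ℝ)| } := by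
    refine ⟨s, fun j => -round (∑ i, Ω j i * (s i : ℝ)), Function.ne_iff.1 h0, fun i => ?_, rfl⟩
    refine le_trans ?_ ht
    exact_mod_cast hb i
  refine (csInf_le ⟨0, ?_⟩ hmem).trans ?_
  · rintro r ⟨bh, bt, -, -, rfl⟩
    exact Real.iSup_nonneg fun _ => abs_nonneg _
  · rw [hmin]
    refine Real.iSup_le (fun j => ?_) (integerDist_nonneg _ _)
    have := (integerDist_le_iff (integerDist_nonneg Ω s)).1 le_rfl j
    push_cast
    rwa [← sub_eq_add_neg]

lemma minDist_le_psiMax (Ω : Fin m → Fin n → ℝ) (N : ℕ) :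
    minDist Ω N ≤ psiMax m n Ω ((N : ℝ) + 1) := by
  refine le_csInf ?_ ?_
  · obtain ⟨s, hs⟩ := nonzeroBox_nonempty n N
    obtain ⟨h0, hb⟩ := mem_nonzeroBox.1 hs
    exact ⟨_, s, 0, Function.ne_iff.1 h0, fun i => by exact_mod_cast hb i, rfl⟩
  · rintro r ⟨bh, bt, h0, hb, rfl⟩
    refine (minDist_le (s := bh) (mem_nonzeroBox.2
      ⟨Function.ne_iff.2 h0, fun i => by exact_mod_cast hb i⟩)).trans ?_
    refine (pi_norm_le_iff_of_nonneg (Real.iSup_nonneg fun _ => abs_nonneg _)).2 fun i => ?_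
    exact (unitAddCircle_norm_le_abs_add _ (bt i)).trans
      (le_ciSup (f := fun j => |(∑ i, Ω j i * (bh i : ℝ)) + (bt j : ℝ)|)
        (Set.finite_range _).bddAbove i)

end minDist

/-- The normalised distance `(N + 2) ^ w * minDist Ω N`, which bounds `t ^ w * ψ_Ω(t)` on
`[N + 1, N + 2)`. -/
noncomputable def scaledDist {m n : ℕ} [NeZero n] (w : ℝ) (Ω : Fin m → Fin n → ℝ) (N : ℕ) : ℝ :=
  ((N : ℝ) + 2) ^ w * minDist Ω N

section scaledDist

variable {m n : ℕ} [NeZero n]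

lemma continuous_scaledDist (w : ℝ) (N : ℕ) :
    Continuous fun Ω : Fin m → Fin n → ℝ => scaledDist w Ω N :=
  continuous_const.mul (continuous_minDist N)

lemma rpow_mul_psiMax_le (Ω : Fin m → Fin n → ℝ) {w t : ℝ} (hw : 0 ≤ w) (ht : 1 ≤ t) :
    t ^ w * psiMax m n Ω t ≤ scaledDist w Ω (⌊t⌋₊ - 1) := by
  have h1 : 1 ≤ ⌊t⌋₊ := Nat.le_floor (by exact_mod_cast ht)
  have h2 : ((⌊t⌋₊ - 1 : ℕ) : ℝ) = (⌊t⌋₊ : ℝ) - 1 := by push_cast [h1]; ring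
  have h3 := Nat.floor_le (zero_le_one.trans ht)
  have h4 := Nat.lt_floor_add_one t
  refine mul_le_mul (Real.rpow_le_rpow (by linarith) (by linarith) hw)
    (psiMax_le_minDist Ω (by linarith)) (psiMax_nonneg _ _) (by positivity)

lemma scaledDist_le_mul_rpow_mul_psiMax (Ω : Fin m → Fin n → ℝ) {w : ℝ} (hw : 0 ≤ w) (N : ℕ) :
    scaledDist w Ω N ≤ 2 ^ w * (((N : ℝ) + 1) ^ w * psiMax m n Ω ((N : ℝ) + 1)) := by
  rw [← mul_assoc, ← Real.mul_rpow (by norm_num) (by positivity)]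
  refine mul_le_mul (Real.rpow_le_rpow (by positivity) ?_ hw) (minDist_le_psiMax Ω N)
    (minDist_nonneg _ _) (by positivity)
  have : (0 : ℝ) ≤ N := by positivity
  linarith

lemma mem_FSmax_of_scaledDist {Ω : Fin m → Fin n → ℝ} {c δ : ℝ} (hc : c < 1) (hδ : 0 < δ)
    (hupper : ∀ᶠ N in atTop, scaledDist (n / m) Ω N ≤ c)
    (hlower : ∃ᶠ N in atTop, δ ≤ scaledDist (n / m) Ω N)
    (hsmall : ∀ η > 0, ∃ᶠ N in atTop, scaledDist (n / m) Ω N ≤ η) :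
    Ω ∈ FSmax m n := by
  have hw : (0 : ℝ) ≤ (n : ℝ) / m := by positivity
  set f : ℝ → ℝ := fun t => t ^ ((n : ℝ) / (m : ℝ)) * psiMax m n Ω t with hf
  have hshift : Tendsto (fun t : ℝ => ⌊t⌋₊ - 1) atTop atTop :=
    (tendsto_sub_atTop_nat 1).comp tendsto_nat_floor_atTop
  have hup : ∀ᶠ t in atTop, f t ≤ c := by
    filter_upwards [hshift.eventually hupper, eventually_ge_atTop (1 : ℝ)] with t ht h1
    exact (rpow_mul_psiMax_le Ω hw h1).trans ht
  have hcast : Tendsto (fun N : ℕ => (N : ℝ) + 1) atTop atTop :=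
    tendsto_atTop_add_const_right _ _ tendsto_natCast_atTop_atTop
  have hlow : ∃ᶠ t in atTop, δ / 2 ^ ((n : ℝ) / m) ≤ f t := by
    refine hcast.frequently (hlower.mono fun N hN => ?_)
    rw [div_le_iff₀' (by positivity)]
    exact hN.trans (scaledDist_le_mul_rpow_mul_psiMax Ω hw N)
  have hsm : ∀ η > 0, ∃ᶠ t in atTop, f t ≤ η := by
    intro η hη
    refine hcast.frequently ((hsmall η hη).mono fun N hN => ?_)
    refine (rpow_mul_psiMax_le Ω hw ?_).trans (le_of_eq_of_le ?_ hN)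
    · have : (0 : ℝ) ≤ N := by positivity
      linarith
    · congr
      have : ⌊(N : ℝ) + 1⌋₊ = N + 1 := by
        have := Nat.floor_natCast (R := ℝ) (N + 1)
        push_cast at this
        exact this
      omega
  have hnn : ∀ᶠ t in atTop, 0 ≤ f t := by
    filter_upwards [eventually_ge_atTop (0 : ℝ)] with t ht
    exact mul_nonneg (by positivity) (psiMax_nonneg _ _)
  have hbdd : IsBoundedUnder (· ≤ ·) atTop f := ⟨c, by simpa using hup⟩
  have hbdd' : IsBoundedUnder (· ≥ ·) atTop f := ⟨0, by simpa using hnn⟩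
  refine ⟨(limsup_le_of_le hbdd'.isCoboundedUnder_le hup).trans_lt hc, ?_⟩
  rintro (h | h)
  · have h : 0 < liminf f atTop := h
    have h5 := eventually_lt_of_lt_liminf (half_lt_self h) hbdd'
    obtain ⟨t, h6, h7⟩ := ((hsm _ (half_pos h)).and_eventually h5).exists
    exact absurd h7 (not_lt.2 h6)
  · have h : limsup f atTop = 0 := h
    have h5 := le_limsup_of_frequently_le hlow hbdd
    have : 0 < δ / 2 ^ ((n : ℝ) / m) := by positivity
    linarith

end scaledDist

section almostRational

variable {m p : ℕ}

lemma integerDist_le_of_forall_exists {Ω : Fin m → Fin p → ℝ} {s : Fin p → ℤ} {ε : ℝ}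
    (hε : 0 ≤ ε) (h : ∀ i, ∃ k : ℤ, |(∑ j, Ω i j * (s j : ℝ)) - k| ≤ ε) :
    integerDist Ω s ≤ ε := by
  rw [integerDist_le_iff hε]
  intro i
  obtain ⟨k, hk⟩ := h i
  exact (round_le _ k).trans hk

lemma sum_mul_single (x : Fin p → ℝ) (j : Fin p) (N : ℤ) :
    ∑ l, x l * ((Pi.single j N : Fin p → ℤ) l : ℝ) = x j * N := by
  rw [Finset.sum_eq_single j]
  · simp
  · intro l _ hl
    simp [hl]
  · simp

lemma single_mem_nonzeroBox {j : Fin p} {N K : ℕ} (hN : 0 < N) (hNK : N ≤ K + 1) :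
    (Pi.single j (N : ℤ) : Fin p → ℤ) ∈ nonzeroBox p K := by
  refine mem_nonzeroBox.2 ⟨by simpa using hN.ne', fun i => ?_⟩
  by_cases h : i = j
  · subst h
    simp
    exact_mod_cast hNK
  · simp [h]
    omega

variable [NeZero p]

lemma minDist_eq_zero_of_column {Y : Fin m → Fin p → ℝ} {j : Fin p} {N K : ℕ} (hN : 0 < N)
    (hNK : N ≤ K + 1) (hY : ∀ i, ∃ k : ℤ, Y i j * N = k) : minDist Y K = 0 := by
  refine le_antisymm ((minDist_le (single_mem_nonzeroBox (j := j) hN hNK)).trans ?_)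
    (minDist_nonneg _ _)
  refine integerDist_le_of_forall_exists le_rfl fun i => ?_
  obtain ⟨k, hk⟩ := hY i
  refine ⟨k, ?_⟩
  rw [sum_mul_single]
  push_cast
  simp [hk]

lemma minDist_le_of_almost_integral {Y : Fin m → Fin 1 → ℝ} {i₀ : Fin m} {N K : ℕ} (hN : 0 < N)
    (hNK : N ≤ K + 1) (hY : ∀ i, i ≠ i₀ → ∃ k : ℤ, Y i 0 * N = k) :
    minDist Y K ≤ N / ((K : ℝ) + 1) := by
  have hQ : 0 < (K + 1) / N := Nat.div_pos hNK hN
  obtain ⟨q, hq0, hqQ, hq⟩ := Real.exists_nat_abs_mul_sub_round_le (Y i₀ 0 * N) hQ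
  have hqN : q * N ≤ K + 1 := (Nat.mul_le_mul_right _ hqQ).trans (Nat.div_mul_le_self _ _)
  have hlt : K + 1 < ((K + 1) / N + 1) * N := by
    have := Nat.lt_div_mul_add (a := K + 1) hN
    rw [add_mul, one_mul]
    exact this
  have hmem := single_mem_nonzeroBox (j := (0 : Fin 1)) (Nat.mul_pos hq0 hN) hqN
  refine (minDist_le hmem).trans
    (integerDist_le_of_forall_exists (by positivity) fun i => ?_)
  rw [sum_mul_single]
  by_cases h : i = i₀
  · subst h
    refine ⟨round (q * (Y i 0 * N)), ?_⟩
    have heq : Y i 0 * ((q * N : ℕ) : ℤ) = q * (Y i 0 * N) := by push_cast; ring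
    rw [heq]
    refine hq.trans ?_
    rw [div_le_div_iff₀ (by positivity) (by positivity), one_mul, mul_comm]
    exact_mod_cast hlt.le
  · obtain ⟨k, hk⟩ := hY i h
    refine ⟨q * k, ?_⟩
    have heq : Y i 0 * ((q * N : ℕ) : ℤ) = q * (Y i 0 * N) := by push_cast; ring
    rw [heq, hk]
    push_cast
    rw [sub_self, abs_zero]
    positivity

/-- A matrix all of whose entries but one have denominator `N` is approximated too well to be
badly approximable, uniformly in the remaining entry. -/
lemma exists_forall_scaledDist_le_of_almost_integral {w : ℝ} (hp : 2 ≤ p ∨ w < 1) {N : ℕ}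
    (hN : 0 < N) {δ : ℝ} (hδ : 0 < δ) :
    ∃ T, ∀ K ≥ T, ∀ (Y : Fin m → Fin p → ℝ) (a : Fin m × Fin p),
      (∀ i j, (i, j) ≠ a → ∃ k : ℤ, Y i j * N = k) → scaledDist w Y K ≤ δ := by
  by_cases h2 : 2 ≤ p
  · refine ⟨N, fun K hK Y a hY => ?_⟩
    have : Nontrivial (Fin p) := Fin.nontrivial_iff_two_le.2 h2
    obtain ⟨j, hj⟩ := exists_ne a.2
    rw [scaledDist, minDist_eq_zero_of_column (j := j) hN (by omega), mul_zero]
    · exact hδ.le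
    · exact fun i => hY i j fun h => hj (congrArg Prod.snd h)
  · have hw : w < 1 := hp.resolve_left h2
    obtain rfl : p = 1 := by have := NeZero.pos p; omega
    have hlim : Tendsto (fun K : ℕ => 2 * (N : ℝ) * ((K : ℝ) + 2) ^ (-(1 - w))) atTop (nhds 0) := by
      have h1 : Tendsto (fun K : ℕ => (K : ℝ) + 2) atTop atTop :=
        tendsto_atTop_add_const_right _ _ tendsto_natCast_atTop_atTop
      simpa using ((tendsto_rpow_neg_atTop (sub_pos.2 hw)).comp h1).const_mul (2 * (N : ℝ))
    obtain ⟨T, hT⟩ := eventually_atTop.1 (hlim.eventually (ge_mem_nhds hδ))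
    refine ⟨max T N, fun K hK Y a hY => ?_⟩
    have hd : minDist Y K ≤ N / ((K : ℝ) + 1) :=
      minDist_le_of_almost_integral (i₀ := a.1) hN (by omega)
        fun i hi => hY i 0 fun h => hi (congrArg Prod.fst h)
    refine le_trans ?_ (hT K (by omega))
    calc scaledDist w Y K ≤ ((K : ℝ) + 2) ^ w * (N / ((K : ℝ) + 1)) :=
          mul_le_mul_of_nonneg_left hd (by positivity)
      _ ≤ ((K : ℝ) + 2) ^ w * (2 * N / ((K : ℝ) + 2)) := by
          refine mul_le_mul_of_nonneg_left ?_ (by positivity)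
          rw [div_le_div_iff₀ (by positivity) (by positivity)]
          have : (0 : ℝ) ≤ N * K := by positivity
          linarith
      _ = 2 * (N : ℝ) * ((K : ℝ) + 2) ^ (-(1 - w)) := by
          rw [neg_sub, Real.rpow_sub_one (by positivity)]
          ring

end almostRational

section perturbation

variable {m p : ℕ}

/-- The real matrix with the given rational entries. -/
def ratMatrix (q : Fin m → Fin p → ℚ) : Fin m → Fin p → ℝ := fun i j => (q i j : ℝ)

lemma denseRange_ratMatrix : DenseRange (ratMatrix : (Fin m → Fin p → ℚ) → Fin m → Fin p → ℝ) :=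
  DenseRange.piMap fun _ => DenseRange.piMap fun _ => Rat.denseRange_cast

lemma exists_denominator (q : Fin m → Fin p → ℚ) :
    ∃ N : ℕ, 0 < N ∧ ∀ i j, ∃ k : ℤ, (q i j : ℝ) * N = k := by
  refine ⟨∏ a : Fin m × Fin p, (q a.1 a.2).den, Finset.prod_pos fun a _ => Rat.den_pos _,
    fun i j => ?_⟩
  obtain ⟨c, hc⟩ := Finset.dvd_prod_of_mem (fun a : Fin m × Fin p => (q a.1 a.2).den)
    (Finset.mem_univ (i, j))
  refine ⟨(q i j).num * c, ?_⟩
  rw [hc]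
  have : ((q i j) * (q i j).den : ℚ) = (q i j).num := Rat.mul_den_eq_num _
  have h : ((q i j : ℝ) * (q i j).den) = (q i j).num := by exact_mod_cast this
  push_cast
  rw [← mul_assoc, h]

variable [NeZero p]

lemma exists_forall_minDist_ratMatrix_eq_zero (q : Fin m → Fin p → ℚ) :
    ∃ T, ∀ K ≥ T, minDist (ratMatrix q) K = 0 := by
  obtain ⟨N, hN, hq⟩ := exists_denominator q
  exact ⟨N, fun K hK => minDist_eq_zero_of_column (j := 0) hN (by omega) fun i => hq i 0⟩

/-- Near a rational matrix there is another one whose scaled distances from time `T` on stay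
below `2 * δ` but exceed `δ / 2` at some time. -/
lemma exists_ratMatrix_near {w δ : ℝ} (hp : 2 ≤ p ∨ w < 1) (hδ : 0 < δ)
    (hdense : ∀ (Ω : Fin m → Fin p → ℝ) (ρ : ℝ), 0 < ρ → ∀ T : ℕ,
      ∃ K ≥ T, ∃ Y, dist Y Ω < ρ ∧ δ < scaledDist w Y K)
    (q : Fin m → Fin p → ℚ) {ρ : ℝ} (hρ : 0 < ρ) {T : ℕ}
    (hT : ∀ K ≥ T, minDist (ratMatrix q) K = 0) :
    ∃ q' : Fin m → Fin p → ℚ, dist (ratMatrix q') (ratMatrix q) < ρ ∧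
      (∀ K ≥ T, scaledDist w (ratMatrix q') K < 2 * δ) ∧
      ∃ K ≥ T, δ / 2 < scaledDist w (ratMatrix q') K := by
  classical
  obtain ⟨K₁, hK₁, Y, hYρ, hYδ⟩ := hdense (ratMatrix q) ρ hρ T
  obtain ⟨q₁, hq₁ρ, hq₁δ⟩ : ∃ q₁ : Fin m → Fin p → ℚ,
      dist (ratMatrix q₁) (ratMatrix q) < ρ ∧ δ < scaledDist w (ratMatrix q₁) K₁ := by
    have hopen : IsOpen {Z : Fin m → Fin p → ℝ | dist Z (ratMatrix q) < ρ ∧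
        δ < scaledDist w Z K₁} :=
      (isOpen_lt (continuous_id.dist continuous_const) continuous_const).inter
        (isOpen_lt continuous_const (continuous_scaledDist w K₁))
    exact denseRange_ratMatrix.exists_mem_open hopen ⟨Y, hYρ, hYδ⟩
  obtain ⟨N₀, hN₀, hd₀⟩ := exists_denominator q
  obtain ⟨N₁, hN₁, hd₁⟩ := exists_denominator q₁
  obtain ⟨T₁, hT₁⟩ := exists_forall_scaledDist_le_of_almost_integral (m := m) hp
    (Nat.mul_pos hN₀ hN₁) hδ
  set T₂ := max K₁ T₁ with hT₂
  have hne : (Finset.Icc T T₂).Nonempty := Finset.nonempty_Icc.2 (by omega)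
  set F : (Fin m → Fin p → ℝ) → ℝ := fun Z => (Finset.Icc T T₂).sup' hne (scaledDist w Z) with hF
  have hFc : Continuous F := Continuous.finset_sup'_apply _ fun K _ => continuous_scaledDist w K
  set mix : Finset (Fin m × Fin p) → Fin m → Fin p → ℚ :=
    fun S i j => if (i, j) ∈ S then q₁ i j else q i j with hmix
  obtain ⟨S, a, haS, hSle, hSlt⟩ : ∃ S : Finset (Fin m × Fin p), ∃ a ∉ S,
      F (ratMatrix (mix S)) ≤ δ ∧ δ < F (ratMatrix (mix (insert a S))) := by
    by_contra! hcon
    have hall : ∀ S : Finset (Fin m × Fin p), F (ratMatrix (mix S)) ≤ δ := by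
      intro S
      induction S using Finset.induction with
      | empty =>
        refine Finset.sup'_le _ _ fun K hK => ?_
        have hmix0 : mix ∅ = q := by ext i j; simp [hmix]
        rw [hmix0, scaledDist, hT K (Finset.mem_Icc.1 hK).1, mul_zero]
        exact hδ.le
      | insert a S ha ih => exact hcon S a ha ih
    have hmix1 : mix Finset.univ = q₁ := by ext i j; simp [hmix]
    have h1 := hall Finset.univ
    rw [hmix1] at h1
    have h2 : scaledDist w (ratMatrix q₁) K₁ ≤ F (ratMatrix q₁) :=
      Finset.le_sup' (scaledDist w (ratMatrix q₁)) (Finset.mem_Icc.2 ⟨hK₁, le_max_left _ _⟩)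
    linarith
  set path : ℝ → Fin m → Fin p → ℝ :=
    fun x i j => if (i, j) = a then x else (mix S i j : ℝ) with hpath
  have hpathc : Continuous path := by
    refine continuous_pi fun i => continuous_pi fun j => ?_
    by_cases h : (i, j) = a
    · simp only [hpath, h, if_true]; exact continuous_id
    · simp only [hpath, h, if_false]; exact continuous_const
  have hpath0 : path (q a.1 a.2) = ratMatrix (mix S) := by
    ext i j
    by_cases h : (i, j) = a
    · subst h; simp [hpath, hmix, ratMatrix, haS]
    · simp [hpath, h, ratMatrix]
  have hpath1 : path (q₁ a.1 a.2) = ratMatrix (mix (insert a S)) := by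
    ext i j
    by_cases h : (i, j) = a
    · subst h; simp [hpath, hmix, ratMatrix]
    · simp [hpath, h, ratMatrix, hmix]
  have hentry : ∀ i j, |(q₁ i j : ℝ) - q i j| < ρ := fun i j =>
    (dist_pi_lt_iff hρ).1 ((dist_pi_lt_iff hρ).1 hq₁ρ i) j
  obtain ⟨x, hx, hFx⟩ : δ ∈ (fun x => F (path x)) '' Set.uIcc (q a.1 a.2 : ℝ) (q₁ a.1 a.2) := by
    refine intermediate_value_uIcc (hFc.comp hpathc).continuousOn (Set.mem_uIcc.2 (Or.inl ?_))
    simp only [Function.comp_apply, hpath0, hpath1]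
    exact ⟨hSle, hSlt.le⟩
  have hxρ : dist (path x) (ratMatrix q) < ρ := by
    refine (dist_pi_lt_iff hρ).2 fun i => (dist_pi_lt_iff hρ).2 fun j => ?_
    by_cases h : (i, j) = a
    · subst h
      simp only [hpath, if_true, ratMatrix, Real.dist_eq]
      exact (Set.abs_sub_left_of_mem_uIcc hx).trans_lt (hentry i j)
    · by_cases h' : (i, j) ∈ S
      · simpa [hpath, h, ratMatrix, hmix, h', Real.dist_eq] using hentry i j
      · simpa [hpath, h, ratMatrix, hmix, h'] using hρ
  obtain ⟨y, hyρ, hy1, hy2⟩ : ∃ y : ℚ, dist (path y) (ratMatrix q) < ρ ∧ δ / 2 < F (path y) ∧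
      F (path y) < 2 * δ := by
    have hopen : IsOpen {y : ℝ | dist (path y) (ratMatrix q) < ρ ∧ δ / 2 < F (path y) ∧
        F (path y) < 2 * δ} :=
      (isOpen_lt (hpathc.dist continuous_const) continuous_const).inter
        ((isOpen_lt continuous_const (hFc.comp hpathc)).inter
          (isOpen_lt (hFc.comp hpathc) continuous_const))
    refine Rat.denseRange_cast.exists_mem_open hopen ⟨x, hxρ, ?_, ?_⟩ <;>
    · have : F (path x) = δ := hFx
      linarith
  have hq' : ratMatrix (fun i j => if (i, j) = a then y else mix S i j) = path y := by
    ext i j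
    by_cases h : (i, j) = a <;> simp [hpath, h, ratMatrix]
  refine ⟨_, hq'.symm ▸ hyρ, ?_, ?_⟩
  · intro K hK
    rw [hq']
    by_cases hK2 : K ≤ T₂
    · exact (Finset.le_sup' (scaledDist w (path y)) (Finset.mem_Icc.2 ⟨hK, hK2⟩)).trans_lt hy2
    · refine (hT₁ K (by omega) (path y) a fun i j h => ?_).trans_lt (by linarith)
      obtain ⟨k₀, hk₀⟩ := hd₀ i j
      obtain ⟨k₁, hk₁⟩ := hd₁ i j
      by_cases h' : (i, j) ∈ S
      · refine ⟨k₁ * N₀, ?_⟩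
        simp only [hpath, h, if_false, hmix, h', if_true]
        push_cast
        rw [← hk₁]
        ring
      · refine ⟨k₀ * N₁, ?_⟩
        simp only [hpath, h, if_false, hmix, h']
        push_cast
        rw [← hk₀]
        ring
  · rw [hq']
    obtain ⟨K, hK, hKF⟩ := Finset.exists_mem_eq_sup' hne (scaledDist w (path y))
    refine ⟨K, (Finset.mem_Icc.1 hK).1, ?_⟩
    rw [← hKF]
    exact hy1

end perturbation

section limit

variable {m p : ℕ} [NeZero p]

/-- A closed ball around a rational matrix, with a time from which that matrix is singular. -/
structure Stage (m p : ℕ) [NeZero p] where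
  /-- the entries of the centre -/
  centre : Fin m → Fin p → ℚ
  /-- the radius of the ball -/
  radius : ℝ
  /-- the time from which the centre has vanishing distances -/
  time : ℕ
  radius_pos : 0 < radius
  minDist_eq_zero : ∀ K ≥ time, minDist (ratMatrix centre) K = 0

/-- The closed ball of a stage. -/
def Stage.ball (x : Stage m p) : Set (Fin m → Fin p → ℝ) :=
  Metric.closedBall (ratMatrix x.centre) x.radius

/-- `y` refines `x` if its ball is smaller and the scaled distances of its matrices are controlled
on the time interval between the two stages. -/
structure Stage.Refines (w δ : ℝ) (x y : Stage m p) : Prop where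
  time_lt : x.time < y.time
  ball_subset : y.ball ⊆ x.ball
  le : ∀ Y ∈ y.ball, ∀ N, x.time ≤ N → N < y.time → scaledDist w Y N ≤ 2 * δ
  ge : ∀ Y ∈ y.ball, ∃ N, x.time ≤ N ∧ δ / 2 ≤ scaledDist w Y N
  small : ∀ Y ∈ y.ball, scaledDist w Y y.time ≤ 1 / (y.time : ℝ)

lemma Stage.exists_refines {w δ : ℝ} (hp : 2 ≤ p ∨ w < 1) (hδ : 0 < δ)
    (hdense : ∀ (Ω : Fin m → Fin p → ℝ) (ρ : ℝ), 0 < ρ → ∀ T : ℕ,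
      ∃ K ≥ T, ∃ Y, dist Y Ω < ρ ∧ δ < scaledDist w Y K)
    (x : Stage m p) : ∃ y : Stage m p, x.Refines w δ y := by
  obtain ⟨q, hqx, hle, K, hKx, hK⟩ :=
    exists_ratMatrix_near hp hδ hdense x.centre x.radius_pos x.minDist_eq_zero
  obtain ⟨T, hT⟩ := exists_forall_minDist_ratMatrix_eq_zero q
  set T' := max T (x.time + 1) with hT'
  have hT'pos : (0 : ℝ) < T' := by
    have : 0 < T' := by omega
    exact_mod_cast this
  set U : Set (Fin m → Fin p → ℝ) :=
    Metric.ball (ratMatrix x.centre) x.radius ∩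
      ((⋂ N ∈ Finset.Ico x.time T', {Y | scaledDist w Y N < 2 * δ}) ∩
      ({Y | δ / 2 < scaledDist w Y K} ∩ {Y | scaledDist w Y T' < 1 / (T' : ℝ)})) with hU
  have hUo : IsOpen U := by
    refine Metric.isOpen_ball.inter ((isOpen_biInter_finset fun N _ => ?_).inter
      (IsOpen.inter ?_ ?_))
    · exact isOpen_lt (continuous_scaledDist w N) continuous_const
    · exact isOpen_lt continuous_const (continuous_scaledDist w K)
    · exact isOpen_lt (continuous_scaledDist w T') continuous_const
  have hqU : ratMatrix q ∈ U := by
    refine ⟨hqx, Set.mem_iInter₂.2 fun N hN => hle N (Finset.mem_Ico.1 hN).1, hK, ?_⟩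
    change scaledDist w (ratMatrix q) T' < 1 / (T' : ℝ)
    rw [scaledDist, hT T' (le_max_left _ _), mul_zero]
    positivity
  obtain ⟨r, hr, hrU⟩ := Metric.nhds_basis_closedBall.mem_iff.1 (hUo.mem_nhds hqU)
  refine ⟨⟨q, r, T', hr, fun N hN => hT N ((le_max_left _ _).trans hN)⟩, ?_, ?_, ?_, ?_, ?_⟩
  · change x.time < T'
    omega
  · exact fun Y hY => Metric.ball_subset_closedBall (hrU hY).1
  · exact fun Y hY N h1 h2 =>
      (Set.mem_iInter₂.1 (hrU hY).2.1 N (Finset.mem_Ico.2 ⟨h1, h2⟩)).le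
  · exact fun Y hY => ⟨K, hKx, (hrU hY).2.2.1.le⟩
  · exact fun Y hY => (hrU hY).2.2.2.le

/-- Near every rational matrix there is a matrix whose scaled distances are eventually at most
`2 * δ`, do not tend to zero, and have lower limit zero. -/
lemma exists_near_ratMatrix_scaledDist {w δ : ℝ} (hp : 2 ≤ p ∨ w < 1) (hδ : 0 < δ)
    (hdense : ∀ (Ω : Fin m → Fin p → ℝ) (ρ : ℝ), 0 < ρ → ∀ T : ℕ,
      ∃ K ≥ T, ∃ Y, dist Y Ω < ρ ∧ δ < scaledDist w Y K)
    (q : Fin m → Fin p → ℚ) {ρ : ℝ} (hρ : 0 < ρ) :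
    ∃ A : Fin m → Fin p → ℝ, dist A (ratMatrix q) ≤ ρ ∧
      (∀ᶠ N in atTop, scaledDist w A N ≤ 2 * δ) ∧
      (∃ᶠ N in atTop, δ / 2 ≤ scaledDist w A N) ∧
      ∀ η > 0, ∃ᶠ N in atTop, scaledDist w A N ≤ η := by
  obtain ⟨T, hT⟩ := exists_forall_minDist_ratMatrix_eq_zero q
  choose f hf using Stage.exists_refines (m := m) (p := p) hp hδ hdense
  set x : ℕ → Stage m p := fun k => f^[k] ⟨q, ρ, T, hρ, hT⟩ with hx
  have hstep : ∀ k, (x k).Refines w δ (x (k + 1)) := fun k => by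
    simp only [hx, Function.iterate_succ_apply']
    exact hf _
  have hmono : StrictMono fun k => (x k).time :=
    strictMono_nat_of_lt_succ fun k => (hstep k).time_lt
  obtain ⟨A, hA⟩ := IsCompact.nonempty_iInter_of_sequence_nonempty_isCompact_isClosed
    (fun k => (x k).ball) (fun k => (hstep k).ball_subset)
    (fun k => Metric.nonempty_closedBall.2 (x k).radius_pos.le)
    (isCompact_closedBall _ _) (fun k => Metric.isClosed_closedBall)
  have hA : ∀ k, A ∈ (x k).ball := Set.mem_iInter.1 hA
  refine ⟨A, hA 0, ?_, ?_, fun η hη => ?_⟩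
  · filter_upwards [eventually_ge_atTop (x 0).time] with N hN
    have hex : ∃ k, N < (x k).time := ⟨N + 1, (Nat.lt_succ_self N).trans_le (hmono.le_apply)⟩
    classical
    have h1 := Nat.find_spec hex
    have h0 : Nat.find hex ≠ 0 := fun h => by rw [h] at h1; omega
    obtain ⟨k, hk⟩ := Nat.exists_eq_succ_of_ne_zero h0
    have h2 := Nat.find_min hex (m := k) (by omega)
    rw [hk] at h1
    exact (hstep k).le A (hA _) N (not_lt.1 h2) h1
  · refine frequently_atTop.2 fun N => ?_
    obtain ⟨K, hK, hδK⟩ := (hstep N).ge A (hA _)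
    exact ⟨K, (hmono.le_apply (x := N)).trans hK, hδK⟩
  · refine frequently_atTop.2 fun N => ?_
    obtain ⟨M, hM⟩ := exists_nat_gt (1 / η)
    have hle : max N M + 1 ≤ (x (max N M + 1)).time := hmono.le_apply
    refine ⟨_, (by omega : N ≤ (x (max N M + 1)).time), ((hstep _).small A (hA _)).trans ?_⟩
    rw [one_div_le (by exact_mod_cast (by omega : 0 < (x (max N M + 1)).time)) hη]
    refine hM.le.trans ?_
    exact_mod_cast (by omega : M ≤ (x (max N M + 1)).time)

end limit

section volume

lemma volume_norm_lt_le {σ : ℤ} (hσ : σ ≠ 0) {ε ρ : ℝ} (hε : 0 < ε) (hε2 : ε ≤ 1 / 2)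
    (hρ : 0 < ρ) (a c : ℝ) :
    volume {u : ℝ | u ∈ Set.Icc a (a + ρ) ∧ ‖((u * σ + c : ℝ) : UnitAddCircle)‖ < ε} ≤
      ENNReal.ofReal (2 * ε * ρ * (1 + 2 / (ρ * |(σ : ℝ)|))) := by
  have hσ' : (σ : ℝ) ≠ 0 := by exact_mod_cast hσ
  have hσpos : 0 < |(σ : ℝ)| := abs_pos.2 hσ'
  obtain ⟨x, hx⟩ : ∃ x : ℝ, ∀ u ∈ Set.Icc a (a + ρ),
      x ≤ u * σ + c ∧ u * σ + c ≤ x + ρ * |(σ : ℝ)| := by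
    rcases lt_or_gt_of_ne hσ' with h | h
    · refine ⟨(a + ρ) * σ + c, fun u hu => ?_⟩
      rw [abs_of_neg h]
      constructor <;> nlinarith [hu.1, hu.2]
    · refine ⟨a * σ + c, fun u hu => ?_⟩
      rw [abs_of_pos h]
      constructor <;> nlinarith [hu.1, hu.2]
  set I : Finset ℤ := Finset.Icc ⌈x - 1 / 2⌉ ⌊x + ρ * |(σ : ℝ)| + 1 / 2⌋ with hI
  have hcover : {u : ℝ | u ∈ Set.Icc a (a + ρ) ∧ ‖((u * σ + c : ℝ) : UnitAddCircle)‖ < ε} ⊆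
      ⋃ k ∈ I, Metric.ball (((k : ℝ) - c) / σ) (ε / |(σ : ℝ)|) := by
    rintro u ⟨hu, hnorm⟩
    rw [UnitAddCircle.norm_eq] at hnorm
    obtain ⟨h1, h2⟩ := hx u hu
    obtain ⟨h3, h4⟩ := abs_lt.1 hnorm
    refine Set.mem_iUnion₂.2 ⟨round (u * σ + c), Finset.mem_Icc.2 ⟨Int.ceil_le.2 ?_,
      Int.le_floor.2 ?_⟩, ?_⟩
    · linarith
    · linarith
    · rw [Metric.mem_ball, Real.dist_eq, lt_div_iff₀ hσpos, ← abs_mul, sub_mul,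
        div_mul_cancel₀ _ hσ', ← sub_add, sub_add_eq_add_sub]
      exact hnorm
  have hcard : (I.card : ℝ) ≤ ρ * |(σ : ℝ)| + 2 := by
    rw [hI, Int.card_Icc]
    have h1 := Int.floor_le (x + ρ * |(σ : ℝ)| + 1 / 2)
    have h2 := Int.le_ceil (x - 1 / 2)
    have h3 : (0 : ℝ) < ρ * |(σ : ℝ)| := by positivity
    rw [← Int.cast_natCast (R := ℝ), Int.toNat_eq_max]
    push_cast
    refine max_le ?_ ?_ <;> linarith
  calc _ ≤ _ := measure_mono hcover
    _ ≤ ∑ k ∈ I, volume (Metric.ball (((k : ℝ) - c) / σ) (ε / |(σ : ℝ)|)) :=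
        measure_biUnion_finset_le _ _
    _ = ENNReal.ofReal (I.card * (2 * (ε / |(σ : ℝ)|))) := by
        simp only [Real.volume_ball, Finset.sum_const, nsmul_eq_mul]
        rw [ENNReal.ofReal_mul (Nat.cast_nonneg _), ENNReal.ofReal_natCast]
    _ ≤ _ := by
        refine ENNReal.ofReal_le_ofReal ?_
        refine (mul_le_mul_of_nonneg_right hcard (by positivity)).trans (le_of_eq ?_)
        field_simp

/-- The cube with lower corner `a` and side `ρ`. -/
def cube {ι : Type*} (a : ι → ℝ) (ρ : ℝ) : Set (ι → ℝ) :=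
  Set.pi Set.univ fun j => Set.Icc (a j) (a j + ρ)

lemma volume_cube {ι : Type*} [Fintype ι] (a : ι → ℝ) {ρ : ℝ} (hρ : 0 ≤ ρ) :
    volume (cube a ρ) = ENNReal.ofReal (ρ ^ Fintype.card ι) := by
  rw [cube, volume_pi_pi]
  simp [ENNReal.ofReal_pow hρ]

lemma measurableSet_cube {ι : Type*} [Fintype ι] (a : ι → ℝ) (ρ : ℝ) :
    MeasurableSet (cube a ρ) :=
  MeasurableSet.univ_pi fun _ => measurableSet_Icc

lemma continuous_norm_linear {ι : Type*} [Fintype ι] (s : ι → ℤ) (c : ℝ) :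
    Continuous fun b : ι → ℝ => ‖((∑ j, b j * (s j : ℝ) + c : ℝ) : UnitAddCircle)‖ :=
  continuous_norm.comp ((AddCircle.continuous_mk' 1).comp (by fun_prop))

lemma volume_row_le {r : ℕ} {s : Fin r → ℤ} {j₀ : Fin r} (hs : s j₀ ≠ 0) {ε ρ : ℝ} (hε : 0 < ε)
    (hε2 : ε ≤ 1 / 2) (hρ : 0 < ρ) (a : Fin r → ℝ) (c : ℝ) :
    volume {b ∈ cube a ρ | ‖((∑ j, b j * (s j : ℝ) + c : ℝ) : UnitAddCircle)‖ < ε} ≤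
      ENNReal.ofReal (2 * ε * (1 + 2 / (ρ * |(s j₀ : ℝ)|)) * ρ ^ r) := by
  obtain ⟨k, rfl⟩ : ∃ k, r = k + 1 := Nat.exists_eq_succ_of_ne_zero (by have := j₀.2; omega)
  set S := {b ∈ cube a ρ | ‖((∑ j, b j * (s j : ℝ) + c : ℝ) : UnitAddCircle)‖ < ε} with hS
  have hSm : MeasurableSet S :=
    (measurableSet_cube a ρ).inter (isOpen_lt (continuous_norm_linear s c)
      continuous_const).measurableSet
  have hvp := volume_preserving_piFinSuccAbove (fun _ : Fin (k + 1) => ℝ) j₀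
  rw [← hvp.symm.measure_preimage hSm.nullMeasurableSet, Measure.volume_eq_prod,
    Measure.prod_apply_symm (hvp.symm.measurable hSm)]
  set β := ENNReal.ofReal (2 * ε * ρ * (1 + 2 / (ρ * |(s j₀ : ℝ)|))) with hβ
  set a' : Fin k → ℝ := fun j => a (j₀.succAbove j) with ha'
  have hsame : ∀ x y, (MeasurableEquiv.piFinSuccAbove (fun _ : Fin (k + 1) => ℝ) j₀).symm
      (x, y) j₀ = x := fun x y => Fin.insertNth_apply_same (α := fun _ => ℝ) j₀ x y
  have hother : ∀ x y j, (MeasurableEquiv.piFinSuccAbove (fun _ : Fin (k + 1) => ℝ) j₀).symm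
      (x, y) (j₀.succAbove j) = y j :=
    fun x y j => Fin.insertNth_apply_succAbove (α := fun _ => ℝ) j₀ x y j
  have hslice : ∀ y : Fin k → ℝ,
      volume ((fun x => (x, y)) ⁻¹' ((MeasurableEquiv.piFinSuccAbove
        (fun _ : Fin (k + 1) => ℝ) j₀).symm ⁻¹' S)) ≤ (cube a' ρ).indicator (fun _ => β) y := by
    intro y
    by_cases hy : y ∈ cube a' ρ
    · rw [Set.indicator_of_mem hy]
      refine le_trans (measure_mono ?_) (volume_norm_lt_le hs hε hε2 hρ (a j₀)
        (∑ j, y j * (s (j₀.succAbove j) : ℝ) + c))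
      rintro x ⟨hx1, hx2⟩
      refine ⟨hsame x y ▸ hx1 j₀ trivial, ?_⟩
      simp only [Fin.sum_univ_succAbove _ j₀, hsame, hother, add_assoc] at hx2
      exact hx2
    · rw [Set.indicator_of_notMem hy]
      refine le_of_eq (measure_mono_null (fun x hx => hy fun j _ => ?_) measure_empty)
      exact hother x y j ▸ hx.1 (j₀.succAbove j) trivial
  refine (lintegral_mono hslice).trans (le_of_eq ?_)
  rw [lintegral_indicator (measurableSet_cube _ _), setLIntegral_const, volume_cube _ hρ.le,
    hβ, ← ENNReal.ofReal_mul (by positivity), Fintype.card_fin]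
  congr 1
  generalize 1 + 2 / (ρ * |(s j₀ : ℝ)|) = x
  ring

/-- The matrices whose rows lie in cubes of side `ρ`. -/
def matrixCube {m r : ℕ} (a : Fin m → Fin r → ℝ) (ρ : ℝ) : Set (Fin m → Fin r → ℝ) :=
  Set.pi Set.univ fun i => cube (a i) ρ

lemma volume_matrixCube {m r : ℕ} (a : Fin m → Fin r → ℝ) {ρ : ℝ} (hρ : 0 ≤ ρ) :
    volume (matrixCube a ρ) = ENNReal.ofReal ((ρ ^ r) ^ m) := by
  rw [matrixCube, volume_pi_pi]
  simp only [volume_cube _ hρ, Finset.prod_const, Finset.card_univ, Fintype.card_fin]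
  rw [ENNReal.ofReal_pow (pow_nonneg hρ r)]

lemma volume_matrix_le {m r : ℕ} {s : Fin r → ℤ} {j₀ : Fin r} (hs : s j₀ ≠ 0) {ε ρ : ℝ}
    (hε : 0 < ε) (hε2 : ε ≤ 1 / 2) (hρ : 0 < ρ) (a : Fin m → Fin r → ℝ) (c : Fin m → ℝ) :
    volume {B ∈ matrixCube a ρ |
        ∀ i, ‖((∑ j, B i j * (s j : ℝ) + c i : ℝ) : UnitAddCircle)‖ < ε} ≤
      ENNReal.ofReal ((2 * ε * (1 + 2 / (ρ * |(s j₀ : ℝ)|))) ^ m * (ρ ^ r) ^ m) := by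
  have hset : {B ∈ matrixCube a ρ |
        ∀ i, ‖((∑ j, B i j * (s j : ℝ) + c i : ℝ) : UnitAddCircle)‖ < ε} =
      Set.pi Set.univ fun i => {b ∈ cube (a i) ρ |
        ‖((∑ j, b j * (s j : ℝ) + c i : ℝ) : UnitAddCircle)‖ < ε} := by
    ext B
    simp only [matrixCube, Set.mem_ofPred_eq, Set.mem_pi, Set.mem_univ, true_implies,
      forall_and]
  rw [hset, volume_pi_pi]
  refine (Finset.prod_le_prod' fun i _ => volume_row_le hs hε hε2 hρ (a i) (c i)).trans ?_
  rw [Finset.prod_const, Finset.card_univ, Fintype.card_fin, ← ENNReal.ofReal_pow (by positivity),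
    mul_pow _ (ρ ^ r)]

end volume

section unionBound

/-- The integer vectors of maximum norm at most `N`. -/
noncomputable def integerBox (n N : ℕ) : Finset (Fin n → ℤ) :=
  Fintype.piFinset fun _ => Finset.Icc (-(N : ℤ)) N

lemma mem_integerBox {n N : ℕ} {s : Fin n → ℤ} : s ∈ integerBox n N ↔ ∀ i, |s i| ≤ (N : ℤ) := by
  simp only [integerBox, Fintype.mem_piFinset, Finset.mem_Icc, abs_le]

lemma card_integerBox (n N : ℕ) : (integerBox n N).card = (2 * N + 1) ^ n := by
  rw [integerBox, Fintype.card_piFinset]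
  simp only [Int.card_Icc, Finset.prod_const, Finset.card_univ, Fintype.card_fin]
  congr 1
  omega

/-- The matrices `B` of a cube for which some `B·s'' + c s'` with `s', s''` integer vectors of norm
at most `K + 1` and `s'' ≠ 0` is within `ε` of the integer vectors. -/
def closeSet {m r : ℕ} (p K : ℕ) (a : Fin m → Fin r → ℝ) (ρ ε : ℝ)
    (c : (Fin p → ℤ) → Fin m → ℝ) : Set (Fin m → Fin r → ℝ) :=
  {B ∈ matrixCube a ρ | ∃ s' ∈ integerBox p (K + 1), ∃ s'' ∈ integerBox r (K + 1), s'' ≠ 0 ∧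
    ∀ i, ‖((∑ j, B i j * (s'' j : ℝ) + c s' i : ℝ) : UnitAddCircle)‖ < ε}

lemma volume_matrix_le_of_ne_zero {m r : ℕ} {s : Fin r → ℤ} (hs : s ≠ 0) {ε ρ : ℝ}
    (hε : 0 < ε) (hε2 : ε ≤ 1 / 2) (hρ : 0 < ρ) {L : ℕ} (hL : 2 / ρ ≤ L) (a : Fin m → Fin r → ℝ)
    (c : Fin m → ℝ) :
    volume {B ∈ matrixCube a ρ |
        ∀ i, ‖((∑ j, B i j * (s j : ℝ) + c i : ℝ) : UnitAddCircle)‖ < ε} ≤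
      ENNReal.ofReal (((4 * ε) ^ m + if s ∈ integerBox r L then
        (2 * ε * (1 + 2 / ρ)) ^ m else 0) * (ρ ^ r) ^ m) := by
  by_cases h : s ∈ integerBox r L
  · obtain ⟨j₀, hj₀⟩ := Function.ne_iff.1 hs
    refine (volume_matrix_le hj₀ hε hε2 hρ a c).trans (ENNReal.ofReal_le_ofReal ?_)
    rw [if_pos h]
    refine mul_le_mul_of_nonneg_right ?_ (by positivity)
    have h1 : (1 : ℝ) ≤ |(s j₀ : ℝ)| := by exact_mod_cast Int.one_le_abs hj₀
    have h2 : (2 * ε * (1 + 2 / (ρ * |(s j₀ : ℝ)|))) ^ m ≤ (2 * ε * (1 + 2 / ρ)) ^ m := by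
      gcongr
      exact le_mul_of_one_le_right hρ.le h1
    have h3 : 0 ≤ (4 * ε) ^ m := by positivity
    linarith
  · obtain ⟨j₀, hj₀⟩ := not_forall.1 (mt mem_integerBox.2 h)
    have h1 : (L : ℝ) ≤ |(s j₀ : ℝ)| := by exact_mod_cast (not_le.1 hj₀).le
    have hne : s j₀ ≠ 0 := by
      rintro h0
      rw [h0, abs_zero] at hj₀
      exact hj₀ (by positivity)
    refine (volume_matrix_le hne hε hε2 hρ a c).trans (ENNReal.ofReal_le_ofReal ?_)
    rw [if_neg h, add_zero]
    refine mul_le_mul_of_nonneg_right ?_ (by positivity)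
    have h2 : 2 / (ρ * |(s j₀ : ℝ)|) ≤ 1 := by
      have hpos : (0 : ℝ) < |(s j₀ : ℝ)| := abs_pos.2 (by exact_mod_cast hne)
      rw [div_le_one (by positivity)]
      have := (div_le_iff₀ hρ).1 (hL.trans h1)
      linarith
    refine pow_le_pow_left₀ (by positivity) ?_ m
    nlinarith

lemma volume_closeSet_le {m r : ℕ} (p K : ℕ) (a : Fin m → Fin r → ℝ) {ρ ε : ℝ} (hε : 0 < ε)
    (hε2 : ε ≤ 1 / 2) (hρ : 0 < ρ) {L : ℕ} (hL : 2 / ρ ≤ L) (c : (Fin p → ℤ) → Fin m → ℝ) :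
    volume (closeSet p K a ρ ε c) ≤ ENNReal.ofReal (((2 * ((K : ℝ) + 2)) ^ p *
      ((2 * ((K : ℝ) + 2)) ^ r * (4 * ε) ^ m + (2 * L + 1) ^ r * (2 * ε * (1 + 2 / ρ)) ^ m)) *
        (ρ ^ r) ^ m) := by
  have hcard : ∀ n : ℕ, ((integerBox n (K + 1)).card : ℝ) ≤ (2 * ((K : ℝ) + 2)) ^ n := by
    intro n
    rw [card_integerBox]
    push_cast
    gcongr
    linarith
  set b : (Fin r → ℤ) → ℝ := fun s => (4 * ε) ^ m + if s ∈ integerBox r L then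
        (2 * ε * (1 + 2 / ρ)) ^ m else 0 with hb
  have hb0 : ∀ s, 0 ≤ b s := fun s => by
    simp only [hb]
    positivity
  have hcover : closeSet p K a ρ ε c ⊆ ⋃ s' ∈ integerBox p (K + 1),
      ⋃ s'' ∈ (integerBox r (K + 1)).erase 0, {B ∈ matrixCube a ρ |
        ∀ i, ‖((∑ j, B i j * (s'' j : ℝ) + c s' i : ℝ) : UnitAddCircle)‖ < ε} := by
    rintro B ⟨hB, s', hs', s'', hs'', h0, h⟩
    exact Set.mem_iUnion₂.2 ⟨s', hs', Set.mem_iUnion₂.2 ⟨s'', Finset.mem_erase.2 ⟨h0, hs''⟩, hB, h⟩⟩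
  have hsum : ∑ s ∈ (integerBox r (K + 1)).erase 0, b s ≤
      (2 * ((K : ℝ) + 2)) ^ r * (4 * ε) ^ m + (2 * L + 1) ^ r * (2 * ε * (1 + 2 / ρ)) ^ m := by
    calc ∑ s ∈ (integerBox r (K + 1)).erase 0, b s ≤ ∑ s ∈ integerBox r (K + 1), b s :=
          Finset.sum_le_sum_of_subset_of_nonneg (Finset.erase_subset _ _) fun s _ _ => hb0 s
      _ = (integerBox r (K + 1)).card * (4 * ε) ^ m + ((integerBox r (K + 1)).filter
            (· ∈ integerBox r L)).card * (2 * ε * (1 + 2 / ρ)) ^ m := by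
          simp only [hb, Finset.sum_add_distrib, Finset.sum_const, nsmul_eq_mul,
            ← Finset.sum_filter]
      _ ≤ _ := by
          have h1 : (((integerBox r (K + 1)).filter (· ∈ integerBox r L)).card : ℝ) ≤
              (2 * L + 1) ^ r := by
            have h2 : ((integerBox r (K + 1)).filter (· ∈ integerBox r L)) ⊆ integerBox r L :=
              fun s hs => (Finset.mem_filter.1 hs).2
            have h3 := Finset.card_le_card h2
            rw [card_integerBox] at h3
            exact_mod_cast h3
          gcongr
          exact hcard r
  calc volume (closeSet p K a ρ ε c) ≤ _ := measure_mono hcover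
    _ ≤ ∑ s' ∈ integerBox p (K + 1), ∑ s'' ∈ (integerBox r (K + 1)).erase 0,
          ENNReal.ofReal (b s'' * (ρ ^ r) ^ m) := by
        refine (measure_biUnion_finset_le _ _).trans (Finset.sum_le_sum fun s' _ => ?_)
        refine (measure_biUnion_finset_le _ _).trans (Finset.sum_le_sum fun s'' hs'' => ?_)
        exact volume_matrix_le_of_ne_zero (Finset.ne_of_mem_erase hs'') hε hε2 hρ hL a (c s')
    _ = ENNReal.ofReal (((integerBox p (K + 1)).card *
          ∑ s ∈ (integerBox r (K + 1)).erase 0, b s) * (ρ ^ r) ^ m) := by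
        rw [← ENNReal.ofReal_sum_of_nonneg fun s _ => mul_nonneg (hb0 s) (by positivity),
          Finset.sum_const, nsmul_eq_mul, mul_assoc,
          ENNReal.ofReal_mul (Nat.cast_nonneg _), ENNReal.ofReal_natCast, Finset.sum_mul]
    _ ≤ _ := by
        refine ENNReal.ofReal_le_ofReal (mul_le_mul_of_nonneg_right ?_ (by positivity))
        exact mul_le_mul (hcard p) hsum (Finset.sum_nonneg fun s _ => hb0 s) (by positivity)

lemma exists_forall_volume_closeSet_le {m p r : ℕ} (hm : 0 < m) (hr : 0 < r) {w δ ρ : ℝ}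
    (hw0 : 0 ≤ w) (hw : (p + r : ℕ) ≤ w * m) (hδ : 0 < δ) (hδ2 : 2 ^ (p + r) * (4 * δ) ≤ 1 / 4)
    (hρ : 0 < ρ) :
    ∃ K₀ : ℕ, ∀ K ≥ K₀, ∀ (a : Fin m → Fin r → ℝ) (c : (Fin p → ℤ) → Fin m → ℝ),
      volume (closeSet p K a ρ (δ * ((K : ℝ) + 2) ^ (-w)) c) ≤
        volume (matrixCube a ρ) / 2 := by
  obtain ⟨L, hL⟩ := exists_nat_ge (2 / ρ)
  have h2pow : (1 : ℝ) ≤ 2 ^ (p + r) := one_le_pow₀ (by norm_num)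
  have h4δ : 4 * δ ≤ 1 / 4 := by nlinarith
  have hfirst : 2 ^ (p + r) * (4 * δ) ^ m ≤ 1 / 4 := by
    refine le_trans ?_ hδ2
    gcongr
    exact pow_le_of_le_one (by positivity) (by linarith) hm.ne'
  set C : ℝ := 2 ^ p * ((2 * L + 1) ^ r * (2 * δ * (1 + 2 / ρ)) ^ m) with hC
  have hCpos : 0 ≤ C := by positivity
  obtain ⟨K₀, hK₀⟩ := exists_nat_ge (4 * C)
  refine ⟨K₀, fun K hK a c => ?_⟩
  set T : ℝ := (K : ℝ) + 2 with hT
  have hT1 : 1 ≤ T := by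
    have : (0 : ℝ) ≤ K := by positivity
    linarith
  have hTC : 4 * C ≤ T := by
    have : (K₀ : ℝ) ≤ K := by exact_mod_cast hK
    linarith
  have hT0 : 0 < T := by linarith
  have hwT : T ^ (-w) ≤ 1 := Real.rpow_le_one_of_one_le_of_nonpos hT1 (by linarith)
  have hwm : (T ^ (-w)) ^ m ≤ (T ^ (p + r))⁻¹ := by
    rw [← Real.rpow_natCast (T ^ (-w)), ← Real.rpow_mul hT0.le, ← Real.rpow_natCast T,
      ← Real.rpow_neg hT0.le]
    exact Real.rpow_le_rpow_of_exponent_le hT1 (by linarith)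
  have hε2 : δ * T ^ (-w) ≤ 1 / 2 := by
    have := mul_le_mul_of_nonneg_left hwT hδ.le
    linarith
  refine (volume_closeSet_le p K a (by positivity) hε2 hρ hL c).trans ?_
  rw [volume_matrixCube a hρ.le, ← ENNReal.ofReal_ofNat 2, ← ENNReal.ofReal_div_of_pos two_pos]
  refine ENNReal.ofReal_le_ofReal ?_
  rw [mul_comm, div_eq_mul_one_div ((ρ ^ r) ^ m)]
  refine mul_le_mul_of_nonneg_left ?_ (by positivity)
  rw [← hT]
  clear_value T
  have e1 : (2 * T) ^ p * ((2 * T) ^ r * (4 * (δ * T ^ (-w))) ^ m) =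
      (2 ^ (p + r) * (4 * δ) ^ m) * (T ^ (p + r) * (T ^ (-w)) ^ m) := by ring
  have e2 : (2 * T) ^ p * ((2 * L + 1) ^ r * (2 * (δ * T ^ (-w)) * (1 + 2 / ρ)) ^ m) =
      C * (T ^ p * (T ^ (-w)) ^ m) := by
    have h : 2 * (δ * T ^ (-w)) * (1 + 2 / ρ) = 2 * δ * (1 + 2 / ρ) * T ^ (-w) := by
      rw [← mul_assoc, mul_right_comm (2 * δ)]
    rw [hC, h, mul_pow 2 T, mul_pow (2 * δ * (1 + 2 / ρ)) (T ^ (-w))]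
    ring
  have b1 : T ^ (p + r) * (T ^ (-w)) ^ m ≤ 1 := by
    refine (mul_le_mul_of_nonneg_left hwm (by positivity)).trans (le_of_eq ?_)
    exact mul_inv_cancel₀ (by positivity)
  have b2 : T ^ p * (T ^ (-w)) ^ m ≤ T⁻¹ := by
    refine (mul_le_mul_of_nonneg_left hwm (by positivity)).trans ?_
    rw [← div_eq_mul_inv, pow_add, div_mul_cancel_left₀ (by positivity)]
    exact inv_anti₀ hT0 (le_self_pow₀ hT1 hr.ne')
  rw [mul_add, e1, e2]
  have c1 : (2 ^ (p + r) * (4 * δ) ^ m) * (T ^ (p + r) * (T ^ (-w)) ^ m) ≤ 1 / 4 := by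
    refine le_trans (mul_le_of_le_one_right (by positivity) b1) hfirst
  have c2 : C * (T ^ p * (T ^ (-w)) ^ m) ≤ 1 / 4 := by
    refine (mul_le_mul_of_nonneg_left b2 hCpos).trans ?_
    rw [← div_eq_mul_inv, div_le_iff₀ hT0]
    linarith
  linarith

end unionBound

section columns

variable {m p r : ℕ}

lemma volume_matrixCube_pos (a : Fin m → Fin r → ℝ) {ρ : ℝ} (hρ : 0 < ρ) :
    0 < volume (matrixCube a ρ) := by
  rw [volume_matrixCube a hρ.le]
  exact ENNReal.ofReal_pos.2 (by positivity)

lemma volume_matrixCube_half_lt (a : Fin m → Fin r → ℝ) {ρ : ℝ} (hρ : 0 < ρ) :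
    volume (matrixCube a ρ) / 2 < volume (matrixCube a ρ) :=
  ENNReal.half_lt_self (volume_matrixCube_pos a hρ).ne'
    (by rw [volume_matrixCube a hρ.le]; exact ENNReal.ofReal_ne_top)

lemma dist_le_of_mem_matrixCube {a B : Fin m → Fin r → ℝ} {ρ : ℝ} (hρ : 0 ≤ ρ)
    (hB : B ∈ matrixCube a ρ) : dist B a ≤ ρ := by
  refine (dist_pi_le_iff hρ).2 fun i => (dist_pi_le_iff hρ).2 fun j => ?_
  have h := hB i trivial j trivial
  rw [Real.dist_eq, abs_le]
  constructor <;> linarith [h.1, h.2]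

lemma le_integerDist_of_forall_not {Ω : Fin m → Fin r → ℝ} {s : Fin r → ℤ} {ε : ℝ}
    (h : ¬ ∀ i, ‖((∑ j, Ω i j * (s j : ℝ) : ℝ) : UnitAddCircle)‖ < ε) :
    ε ≤ integerDist Ω s := by
  obtain ⟨i, hi⟩ := not_forall.1 h
  exact (not_lt.1 hi).trans
    (norm_le_pi_norm (fun i => ((∑ j, Ω i j * (s j : ℝ) : ℝ) : UnitAddCircle)) i)

lemma rpow_mul_mul_rpow_neg (w δ : ℝ) (K : ℕ) :
    ((K : ℝ) + 2) ^ w * (δ * ((K : ℝ) + 2) ^ (-w)) = δ := by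
  have h : (0 : ℝ) < ((K : ℝ) + 2) ^ w := by positivity
  rw [Real.rpow_neg (by positivity), mul_left_comm, mul_inv_cancel₀ h.ne', mul_one]

/-- Near every matrix and at arbitrarily large times there is a matrix with large scaled
distance. -/
lemma exists_dist_lt_and_lt_scaledDist [NeZero p] (hm : 0 < m) {w δ : ℝ} (hw0 : 0 ≤ w)
    (hw : (p : ℝ) ≤ w * m) (hδ : 0 < δ) (hδ2 : 2 ^ p * (4 * δ) ≤ 1 / 4)
    (Ω : Fin m → Fin p → ℝ) {ρ : ℝ} (hρ : 0 < ρ) (T : ℕ) :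
    ∃ K ≥ T, ∃ Y, dist Y Ω < ρ ∧ δ / 2 < scaledDist w Y K := by
  obtain ⟨K₀, hK₀⟩ := exists_forall_volume_closeSet_le (p := 0) hm (NeZero.pos p) hw0
    (by simpa using hw) hδ (by simpa using hδ2) (half_pos hρ)
  set K := max T K₀ with hK
  have hvol := (hK₀ K (le_max_right _ _) Ω 0).trans_lt
    (volume_matrixCube_half_lt Ω (half_pos hρ))
  obtain ⟨B, hB, hBc⟩ := Set.not_subset.1 fun h => (measure_mono h).not_gt hvol
  refine ⟨K, le_max_left _ _, B,
    (dist_le_of_mem_matrixCube (half_pos hρ).le hB).trans_lt (half_lt_self hρ), ?_⟩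
  have hmin : δ * ((K : ℝ) + 2) ^ (-w) ≤ minDist B K := by
    refine le_minDist_iff.2 fun s hs => le_integerDist_of_forall_not fun hlt => hBc ⟨hB, 0, ?_, s,
      ?_, (mem_nonzeroBox.1 hs).1, ?_⟩
    · exact mem_integerBox.2 fun i => i.elim0
    · exact mem_integerBox.2 fun i => by exact_mod_cast (mem_nonzeroBox.1 hs).2 i
    · simpa using hlt
  calc δ / 2 < δ := half_lt_self hδ
    _ = ((K : ℝ) + 2) ^ w * (δ * ((K : ℝ) + 2) ^ (-w)) := (rpow_mul_mul_rpow_neg w δ K).symm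
    _ ≤ scaledDist w B K := mul_le_mul_of_nonneg_left hmin (by positivity)

/-- The matrix with columns those of `A` followed by those of `B`. -/
def appendColumns (A : Fin m → Fin p → ℝ) (B : Fin m → Fin r → ℝ) : Fin m → Fin (p + r) → ℝ :=
  fun i => Fin.append (A i) (B i)

lemma sum_appendColumns (A : Fin m → Fin p → ℝ) (B : Fin m → Fin r → ℝ) (s : Fin (p + r) → ℤ)
    (i : Fin m) : ∑ j, appendColumns A B i j * (s j : ℝ) =
      ∑ j, A i j * (s (Fin.castAdd r j) : ℝ) + ∑ j, B i j * (s (Fin.natAdd p j) : ℝ) := by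
  simp only [appendColumns, Fin.sum_univ_add, Fin.append_left, Fin.append_right]

lemma exists_forall_volume_closeSet_le_half (hm : 0 < m) {w δ ρ : ℝ} (hw0 : 0 ≤ w)
    (hw : (p + r : ℕ) ≤ w * m) (hδ : 0 < δ) (hδ2 : 2 ^ (p + r) * (4 * δ) ≤ 1 / 4) (hρ : 0 < ρ) :
    ∃ K₀ : ℕ, ∀ K ≥ K₀, ∀ (a : Fin m → Fin r → ℝ) (c : (Fin p → ℤ) → Fin m → ℝ),
      volume (closeSet p K a ρ (δ * ((K : ℝ) + 2) ^ (-w)) c) ≤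
        volume (matrixCube a ρ) / 2 := by
  rcases r.eq_zero_or_pos with rfl | hr
  · refine ⟨0, fun K _ a c => ?_⟩
    refine (measure_mono_null (fun B hB => ?_) measure_empty).le.trans zero_le
    obtain ⟨-, s', -, s'', -, h0, -⟩ := hB
    exact h0 (Subsingleton.elim _ _)
  · exact exists_forall_volume_closeSet_le hm hr hw0 hw hδ hδ2 hρ

variable [NeZero p] [NeZero (p + r)]

lemma minDist_appendColumns_le (A : Fin m → Fin p → ℝ) (B : Fin m → Fin r → ℝ) (N : ℕ) :
    minDist (appendColumns A B) N ≤ minDist A N := by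
  obtain ⟨s, hs, hmin⟩ := exists_integerDist_eq_minDist A N
  obtain ⟨h0, hb⟩ := mem_nonzeroBox.1 hs
  have hmem : (Fin.append s 0 : Fin (p + r) → ℤ) ∈ nonzeroBox (p + r) N := by
    refine mem_nonzeroBox.2 ⟨fun h => h0 ?_, fun i => ?_⟩
    · ext j
      simpa using congrFun h (Fin.castAdd r j)
    · refine Fin.addCases (fun j => ?_) (fun j => ?_) i
      · simpa using hb j
      · simp
        omega
  refine (minDist_le hmem).trans (le_of_eq ?_)
  rw [hmin, integerDist, integerDist]
  simp only [sum_appendColumns, Fin.append_left, Fin.append_right]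
  simp

lemma min_le_minDist_appendColumns {A : Fin m → Fin p → ℝ}
    {a B : Fin m → Fin r → ℝ} {ρ ε : ℝ} {K : ℕ} (hB : B ∈ matrixCube a ρ)
    (hBc : B ∉ closeSet p K a ρ ε fun s i => ∑ j, A i j * (s j : ℝ)) :
    min (minDist A K) ε ≤ minDist (appendColumns A B) K := by
  refine le_minDist_iff.2 fun s hs => ?_
  obtain ⟨h0, hb⟩ := mem_nonzeroBox.1 hs
  by_cases h : (fun j => s (Fin.natAdd p j)) = 0
  · refine (min_le_left _ _).trans ?_
    have hmem : (fun j => s (Fin.castAdd r j)) ∈ nonzeroBox p K := by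
      refine mem_nonzeroBox.2 ⟨fun h' => h0 ?_, fun i => hb _⟩
      ext i
      exact Fin.addCases (fun j => congrFun h' j) (fun j => congrFun h j) i
    refine (minDist_le hmem).trans (le_of_eq ?_)
    have h' : ∀ j, s (Fin.natAdd p j) = 0 := fun j => congrFun h j
    rw [integerDist, integerDist]
    simp only [sum_appendColumns, h']
    simp
  · refine (min_le_right _ _).trans (le_integerDist_of_forall_not fun hlt => hBc ⟨hB,
      fun j => s (Fin.castAdd r j), ?_, fun j => s (Fin.natAdd p j), ?_, h, fun i => ?_⟩)
    · exact mem_integerBox.2 fun i => by exact_mod_cast hb _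
    · exact mem_integerBox.2 fun i => by exact_mod_cast hb _
    · rw [add_comm, ← sum_appendColumns]
      exact hlt i

/-- Appending columns chosen from a set of positive volume preserves the non-vanishing of the upper
limit of the scaled distances. -/
lemma exists_volume_ne_zero_appendColumns (hm : 0 < m) {w δ δ' ρ : ℝ} (hw0 : 0 ≤ w)
    (hw : (p + r : ℕ) ≤ w * m) (hδ : 0 < δ) (hδ2 : 2 ^ (p + r) * (4 * δ) ≤ 1 / 4) (hρ : 0 < ρ)
    {A : Fin m → Fin p → ℝ} (hA : ∃ᶠ N in atTop, δ' ≤ scaledDist w A N)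
    (a : Fin m → Fin r → ℝ) :
    ∃ S ⊆ matrixCube a ρ, volume S ≠ 0 ∧
      ∀ B ∈ S, ∃ᶠ N in atTop, min δ' δ ≤ scaledDist w (appendColumns A B) N := by
  obtain ⟨K₀, hK₀⟩ := exists_forall_volume_closeSet_le_half (p := p) (r := r) hm hw0 hw hδ hδ2 hρ
  set E : ℕ → Set (Fin m → Fin r → ℝ) := fun K => closeSet p K a ρ (δ * ((K : ℝ) + 2) ^ (-w))
    fun s i => ∑ j, A i j * (s j : ℝ) with hE
  set V : ℕ → Set (Fin m → Fin r → ℝ) := fun k => {B | ∀ K ≥ k, δ' ≤ scaledDist w A K → B ∈ E K}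
    with hV
  have hVmono : Monotone V := fun k l hkl B hB K hK => hB K (hkl.trans hK)
  have hVle : volume (⋃ k, V k) ≤ volume (matrixCube a ρ) / 2 := by
    rw [hVmono.measure_iUnion]
    refine iSup_le fun k => ?_
    obtain ⟨K, hK, hKA⟩ := frequently_atTop.1 hA (max k K₀)
    have hsub : V k ⊆ E K := fun B hB => hB K ((le_max_left _ _).trans hK) hKA
    exact (measure_mono hsub).trans
      (hK₀ K ((le_max_right _ _).trans hK) a _)
  refine ⟨matrixCube a ρ \ ⋃ k, V k, Set.sdiff_subset, fun h => ?_, fun B hB => ?_⟩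
  · refine (volume_matrixCube_half_lt a hρ).not_ge ?_
    calc volume (matrixCube a ρ) ≤ volume ((matrixCube a ρ \ ⋃ k, V k) ∪ ⋃ k, V k) :=
          measure_mono (by rw [Set.sdiff_union_self]; exact Set.subset_union_left)
      _ ≤ _ := measure_union_le _ _
      _ ≤ _ := by rw [h, zero_add]; exact hVle
  · refine frequently_atTop.2 fun k => ?_
    have hk : B ∉ V k := fun h => hB.2 (Set.mem_iUnion.2 ⟨k, h⟩)
    simp only [hV, Set.mem_ofPred_eq, not_forall] at hk
    obtain ⟨K, hK, hKA, hKE⟩ := hk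
    refine ⟨K, hK, ?_⟩
    have hle := mul_le_mul_of_nonneg_left (min_le_minDist_appendColumns hB.1 hKE)
      (by positivity : (0 : ℝ) ≤ ((K : ℝ) + 2) ^ w)
    rw [mul_min_of_nonneg _ _ (by positivity), rpow_mul_mul_rpow_neg] at hle
    exact (min_le_min_right δ hKA).trans hle

end columns

section dimension

lemma le_dimH_of_volume_ne_zero {m r : ℕ} {S : Set (Fin m → Fin r → ℝ)} (hS : volume S ≠ 0) :
    ((m * r : ℕ) : ℝ≥0∞) ≤ dimH S := by
  have hfin : Module.finrank ℝ (Fin m → Fin r → ℝ) = m * r := by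
    simp [Module.finrank_pi_fintype]
  have hne : Measure.hausdorffMeasure (Module.finrank ℝ (Fin m → Fin r → ℝ) : ℝ) S ≠ 0 :=
    fun h => hS (Measure.absolutelyContinuous_isAddHaarMeasure volume
      (Measure.hausdorffMeasure (Module.finrank ℝ (Fin m → Fin r → ℝ) : ℝ)) h)
  rw [hfin] at hne
  have := le_dimH_of_hausdorffMeasure_ne_zero (d := ((m * r : ℕ) : NNReal)) (s := S)
    (by simpa using hne)
  simpa using this

lemma dimH_le_dimH_of_forall_appendColumns_mem {m p r : ℕ} {A : Fin m → Fin p → ℝ}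
    {S : Set (Fin m → Fin r → ℝ)} {F : Set (Fin m → Fin (p + r) → ℝ)}
    (h : ∀ B ∈ S, appendColumns A B ∈ F) : dimH S ≤ dimH F := by
  set proj : (Fin m → Fin (p + r) → ℝ) → Fin m → Fin r → ℝ :=
    fun Ω i j => Ω i (Fin.natAdd p j) with hproj
  have hlip : LipschitzWith 1 proj := by
    refine LipschitzWith.of_dist_le_mul fun Ω Ω' => ?_
    rw [NNReal.coe_one, one_mul]
    refine (dist_pi_le_iff dist_nonneg).2 fun i => (dist_pi_le_iff dist_nonneg).2 fun j => ?_
    exact (dist_le_pi_dist (Ω i) (Ω' i) _).trans (dist_le_pi_dist Ω Ω' i)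
  have hsub : S ⊆ proj '' F := fun B hB => ⟨_, h B hB, by ext i j; simp [hproj, appendColumns]⟩
  exact (dimH_mono hsub).trans (hlip.dimH_image_le F)

end dimension

section rank

/-- The rational matrix with ones on the diagonal and zeros elsewhere. -/
def diagonalOnes (m n : ℕ) : Fin m → Fin n → ℚ := fun i j => if i.val = j.val then 1 else 0

lemma exists_forall_dist_le_rank_eq (m n : ℕ) :
    ∃ ρ > 0, ∀ Ω : Fin m → Fin n → ℝ, dist Ω (ratMatrix (diagonalOnes m n)) ≤ ρ →
      (Matrix.of Ω).rank = min m n := by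
  set minor : (Fin m → Fin n → ℝ) → Matrix (Fin (min m n)) (Fin (min m n)) ℝ :=
    fun Ω => (Matrix.of Ω).submatrix (Fin.castLE (min_le_left m n)) (Fin.castLE (min_le_right m n))
    with hminor
  have hcont : Continuous fun Ω => (minor Ω).det := by
    refine Continuous.matrix_det (continuous_matrix fun i j => ?_)
    exact continuous_apply_apply (Fin.castLE (min_le_left m n) i) (Fin.castLE (min_le_right m n) j)
  have hone : minor (ratMatrix (diagonalOnes m n)) = 1 := by
    ext i j
    by_cases h : i = j
    · subst h
      simp [hminor, ratMatrix, diagonalOnes]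
    · simp [hminor, ratMatrix, diagonalOnes, h, Fin.val_ne_of_ne h]
  have hopen : IsOpen {Ω | (minor Ω).det ≠ 0} := isOpen_ne_fun hcont continuous_const
  obtain ⟨ρ, hρ, hball⟩ := Metric.nhds_basis_closedBall.mem_iff.1
    (hopen.mem_nhds (show (minor (ratMatrix (diagonalOnes m n))).det ≠ 0 by simp [hone]))
  refine ⟨ρ, hρ, fun Ω hΩ => le_antisymm (le_min ?_ ?_) ?_⟩
  · exact Matrix.rank_le_height _
  · exact Matrix.rank_le_width _
  · have hdet : (minor Ω).det ≠ 0 := hball hΩ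
    have hrank := Matrix.rank_of_isUnit (minor Ω)
      ((Matrix.isUnit_iff_isUnit_det _).2 (isUnit_iff_ne_zero.2 hdet))
    rw [Fintype.card_fin] at hrank
    rw [← hrank]
    exact Matrix.rank_submatrix_le _ _ _

end rank

/-- If all but `r` columns can be constructed by perturbing rational matrices, then the Folklore set
is non-empty of dimension at least `m * r` and has a matrix of full rank. -/
lemma FSmax_nonempty_of_split {m n p r : ℕ} (hm : 0 < m) (hp0 : 0 < p) (hn : n = p + r)
    (hp : 2 ≤ p ∨ (n : ℝ) / m < 1) :
    (FSmax m n).Nonempty ∧ ((m * r : ℕ) : ℝ≥0∞) ≤ dimH (FSmax m n) ∧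
      ∃ Ω ∈ FSmax m n, (Matrix.of Ω).rank = min m n := by
  subst hn
  have : NeZero p := ⟨hp0.ne'⟩
  have : NeZero (p + r) := ⟨by omega⟩
  set w : ℝ := ((p + r : ℕ) : ℝ) / m with hw
  have hw0 : 0 ≤ w := by positivity
  have hwm : w * m = (p + r : ℕ) := div_mul_cancel₀ _ (by positivity)
  obtain ⟨ρ, hρ, hrank⟩ := exists_forall_dist_le_rank_eq m (p + r)
  set δ : ℝ := 1 / (16 * 2 ^ (p + r)) with hδ
  have hδ0 : 0 < δ := by positivity
  have hδ2 : 2 ^ (p + r) * (4 * δ) ≤ 1 / 4 := by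
    rw [hδ]
    field_simp
    norm_num
  have hδp : 2 ^ p * (4 * δ) ≤ 1 / 4 := by
    refine le_trans ?_ hδ2
    gcongr
    · norm_num
    · omega
  have hδ1 : δ < 1 := by
    have h : (1 : ℝ) ≤ 2 ^ p := one_le_pow₀ (by norm_num)
    nlinarith
  have hpw : (p : ℝ) ≤ w * m := by
    rw [hwm]
    exact_mod_cast Nat.le_add_right p r
  obtain ⟨A, hAρ, hup, hlow, hsmall⟩ := exists_near_ratMatrix_scaledDist hp (half_pos hδ0)
    (fun Ω ρ hρ T => exists_dist_lt_and_lt_scaledDist hm hw0 hpw hδ0 hδp Ω hρ T)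
    (fun i j => diagonalOnes m (p + r) i (Fin.castAdd r j)) hρ
  obtain ⟨S, hSQ, hS0, hS⟩ := exists_volume_ne_zero_appendColumns (r := r) hm hw0 hwm.ge hδ0 hδ2 hρ
    hlow (ratMatrix fun i j => diagonalOnes m (p + r) i (Fin.natAdd p j))
  have hle : ∀ B N, scaledDist w (appendColumns A B : Fin m → Fin (p + r) → ℝ) N ≤
      scaledDist w A N := fun B N =>
    mul_le_mul_of_nonneg_left (minDist_appendColumns_le A B N) (by positivity)
  have hmem : ∀ B ∈ S, appendColumns A B ∈ FSmax m (p + r) := fun B hB =>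
    mem_FSmax_of_scaledDist (c := 2 * (δ / 2)) (δ := min (δ / 2 / 2) δ) (by linarith)
      (by positivity) (hup.mono fun N hN => (hle B N).trans hN) (hS B hB)
      fun η hη => (hsmall η hη).mono fun N hN => (hle B N).trans hN
  obtain ⟨B, hB⟩ := nonempty_of_measure_ne_zero hS0
  refine ⟨⟨_, hmem B hB⟩, (le_dimH_of_volume_ne_zero hS0).trans
    (dimH_le_dimH_of_forall_appendColumns_mem hmem), _, hmem B hB, hrank _ ?_⟩
  have hBρ := dist_le_of_mem_matrixCube hρ.le (hSQ hB)
  refine (dist_pi_le_iff hρ.le).2 fun i => (dist_pi_le_iff hρ.le).2 fun j => ?_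
  refine Fin.addCases (fun j => ?_) (fun j => ?_) j
  · simpa [appendColumns, ratMatrix] using
      ((dist_pi_le_iff hρ.le).1 ((dist_pi_le_iff hρ.le).1 hAρ i) j)
  · simpa [appendColumns, ratMatrix] using
      ((dist_pi_le_iff hρ.le).1 ((dist_pi_le_iff hρ.le).1 hBρ i) j)

/-- if the unordered pair `{m,n}` is not `{1,1}`, not `{2,3}` and not
`{k,k+2}` for any `k ≥ 3`, then `FS_{m,n} ≠ ∅`, `dim_H FS_{m,n} ≥ mn − 2·max{m,n}`, and
the matrices can be chosen of full rank `min{m,n}`. -/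
theorem FSmax_nonempty (m n : ℕ) (hm : 0 < m) (hn : 0 < n)
    (h1 : ¬(m = 1 ∧ n = 1))
    (h2 : ¬((m = 2 ∧ n = 3) ∨ (m = 3 ∧ n = 2)))
    (h3 : ∀ k : ℕ, 3 ≤ k → ¬((m = k ∧ n = k + 2) ∨ (m = k + 2 ∧ n = k))) :
    (FSmax m n).Nonempty ∧
    ((m * n - 2 * max m n : ℕ) : ℝ≥0∞) ≤ dimH (FSmax m n) ∧
    ∃ Ω ∈ FSmax m n, (Matrix.of Ω).rank = min m n := by
  rcases (show n = 1 ∨ 2 ≤ n by omega) with rfl | hn2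
  · have hm2 : (1 : ℝ) < m := by exact_mod_cast (by omega : 1 < m)
    obtain ⟨hne, -, hrank⟩ := FSmax_nonempty_of_split (p := 1) (r := 0) hm one_pos rfl
      (Or.inr (by rw [Nat.cast_one, div_lt_one (by linarith)]; exact hm2))
    refine ⟨hne, ?_, hrank⟩
    rw [show m * 1 - 2 * max m 1 = 0 by omega, Nat.cast_zero]
    exact zero_le
  · obtain ⟨r, rfl⟩ := Nat.exists_eq_add_of_le hn2
    obtain ⟨hne, hdim, hrank⟩ := FSmax_nonempty_of_split (p := 2) hm two_pos rfl (Or.inl le_rfl)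
    refine ⟨hne, le_trans ?_ hdim, hrank⟩
    have h : m * (2 + r) - 2 * max m (2 + r) ≤ m * r := by
      have := le_max_left m (2 + r)
      rw [mul_add]
      omega
    exact_mod_cast h
end
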